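/- arXiv:2504.15762 — 12 statements merged into one kernel-verified Lean document; each statement's English description precedes it below -/
import Mathlib

section
/- Let G be a group and let Z be a finitely generated subgroup of the center of G such that the quotient group G/Z is double coset separable. Then G is double coset separable if and only if G is subgroup separable. -/
open scoped Pointwise

/-- A subset `S` of a group `G` is separable if every `g ∉ S` is excluded from `S`
by a finite-index normal subgroup: `gN ∩ S = ∅`. -/
def SeparableSubset {G : Type*} [Group G] (S : Set G) : Prop :=
  ∀ g : G, g ∉ S → ∃ N : Subgroup G, N.Normal ∧ N.FiniteIndex ∧ ∀ x ∈ N, g * x ∉ S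

/-- A group is subgroup separable if each of its finitely generated subgroups is separable. -/
def SubgroupSeparable (G : Type*) [Group G] : Prop :=
  ∀ H : Subgroup G, H.FG → SeparableSubset (H : Set G)

/-- A group is double coset separable if the product of any two finitely generated
subgroups is separable. -/
def DoubleCosetSeparable (G : Type*) [Group G] : Prop :=
  ∀ H K : Subgroup G, H.FG → K.FG → SeparableSubset ((H : Set G) * (K : Set G))

/-- A group is `n`-coset separable if the product of any `n` finitely generated
subgroups is separable. -/
def NCosetSeparable (G : Type*) [Group G] (n : ℕ) : Prop :=
  ∀ H : Fin n → Subgroup G, (∀ i, (H i).FG) →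
    SeparableSubset ((List.ofFn fun i => ((H i : Set G))).prod)

/-- A group is product separable if it is `n`-coset separable for every `n`. -/
def ProductSeparable (G : Type*) [Group G] : Prop :=
  ∀ n : ℕ, NCosetSeparable G n

/-- A subgroup of the center is normal. -/
lemma normal_of_le_center {G : Type*} [Group G] {Z : Subgroup G}
    (hZ : Z ≤ Subgroup.center G) : Z.Normal :=
  ⟨fun z hz g => by
    have h : g * z = z * g := Subgroup.mem_center_iff.mp (hZ hz) g
    have : g * z * g⁻¹ = z := by rw [h]; group
    rw [this]; exact hz⟩

/-- `(h₁, …, hₙ)` is a product representative of `g` with respect to subgroups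
`H₁, …, Hₙ` if `hᵢ ∈ Hᵢ` for each `i` and `g = h₁ ⋯ hₙ`. -/
def IsProductRep {G : Type*} [Group G] {n : ℕ} (H : Fin n → Subgroup G) (g : G)
    (h : Fin n → G) : Prop :=
  (∀ i, h i ∈ H i) ∧ (List.ofFn h).prod = g

/-- Two product representatives `(h₁, …, hₙ)` and `(k₁, …, kₙ)` are equivalent if
there are elements `sᵢ ∈ Hᵢ ∩ Hᵢ₊₁` (with `s₀ = sₙ = 1`) such that
`sᵢ₋₁ kᵢ = hᵢ sᵢ` for each `i`.  Here `s` is indexed by the `n + 1` "boundaries". -/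
def RepEquiv {G : Type*} [Group G] {n : ℕ} (H : Fin n → Subgroup G)
    (h k : Fin n → G) : Prop :=
  ∃ s : Fin (n + 1) → G,
    s 0 = 1 ∧ s (Fin.last n) = 1 ∧
    (∀ i : Fin n, ∀ hi : (i : ℕ) + 1 < n, s i.succ ∈ H i ⊓ H ⟨(i : ℕ) + 1, hi⟩) ∧
    (∀ i : Fin n, s i.castSucc * k i = h i * s i.succ)

/-- A group has bottlenecked product representatives over a class `C` of subgroups
if for every `n ≥ 1`, subgroups `H₁, …, Hₙ ∈ C` and `g ∈ H₁ ⋯ Hₙ`, there is a set `R`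
of product representatives of `g` whose projection to some coordinate is finite,
such that every product representative of `g` is equivalent to a member of `R`. -/
def HasBottleneckedProductReps (G : Type*) [Group G] (C : Subgroup G → Prop) : Prop :=
  ∀ n : ℕ, 0 < n → ∀ H : Fin n → Subgroup G, (∀ i, C (H i)) →
    ∀ g ∈ (List.ofFn fun i => ((H i : Set G))).prod,
      ∃ R : Set (Fin n → G),
        (∀ h ∈ R, IsProductRep H g h) ∧
        (∃ i : Fin n, ((fun h : Fin n → G => h i) '' R).Finite) ∧
        (∀ h : Fin n → G, IsProductRep H g h → ∃ k ∈ R, RepEquiv H h k)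

/-- A group is residually finite if every nontrivial element survives in some
finite quotient. -/
def ResiduallyFinite (G : Type*) [Group G] : Prop :=
  ∀ g : G, g ≠ 1 → ∃ N : Subgroup G, N.Normal ∧ N.FiniteIndex ∧ g ∉ N

lemma sg_fg_map {G G' : Type*} [Group G] [Group G'] (f : G →* G') {H : Subgroup G}
    (h : H.FG) : (H.map f).FG := by
  rw [Subgroup.fg_iff] at h ⊢
  obtain ⟨S, hS, hf⟩ := h
  exact ⟨f '' S, by rw [← MonoidHom.map_closure, hS], hf.image f⟩

lemma comm_sub_fg {A : Type*} [CommGroup A] (hA : Group.FG A) (B : Subgroup A) : B.FG := by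
  rw [Subgroup.fg_iff_add_fg]
  have h1 : AddGroup.FG (Additive A) := inferInstance
  have h2 : Module.Finite ℤ (Additive A) := Module.Finite.iff_addGroup_fg.mpr h1
  have h3 : IsNoetherian ℤ (Additive A) := inferInstance
  have h4 := h3.noetherian (AddSubgroup.toIntSubmodule (Subgroup.toAddSubgroup B))
  rw [Submodule.fg_iff_addSubgroup_fg] at h4
  exact h4

lemma central_sub_fg {G : Type*} [Group G] {Z A : Subgroup G} (hZ : Z ≤ Subgroup.center G)
    (hfg : Z.FG) (hA : A ≤ Z) : A.FG := by
  letI : CommGroup Z :=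
    { (inferInstance : Group Z) with
      mul_comm := fun a b => Subtype.ext (Subgroup.mem_center_iff.mp (hZ b.2) a) }
  have h := comm_sub_fg ((Group.fg_iff_subgroup_fg Z).mpr hfg) (A.subgroupOf Z)
  have h2 := sg_fg_map Z.subtype h
  rwa [Subgroup.subgroupOf_map_subtype, inf_eq_left.mpr hA] at h2

lemma inf_fin_fg {G : Type*} [Group G] {H N : Subgroup G} (hH : H.FG) (hN : N.FiniteIndex) :
    (N ⊓ H).FG := by
  have := (Group.fg_iff_subgroup_fg H).mpr hH
  have h1 : Group.FG (N.subgroupOf H) := Subgroup.fg_of_index_ne_zero _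
  have h2 := sg_fg_map H.subtype ((Group.fg_iff_subgroup_fg _).mp h1)
  rwa [Subgroup.subgroupOf_map_subtype] at h2

lemma fin_cosets {G : Type*} [Group G] (H N : Subgroup G) (hN : N.FiniteIndex) :
    ∃ F : Set G, F.Finite ∧ F ⊆ H ∧ ∀ h ∈ H, ∃ f ∈ F, f⁻¹ * h ∈ N := by
  have : Finite (H ⧸ N.subgroupOf H) := Subgroup.finite_quotient_of_finiteIndex
  refine ⟨Set.range (fun q : H ⧸ N.subgroupOf H => (q.out : G)), Set.finite_range _, ?_, ?_⟩
  · rintro _ ⟨q, rfl⟩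
    exact q.out.2
  · intro h hh
    refine ⟨_, ⟨(QuotientGroup.mk (⟨h, hh⟩ : H)), rfl⟩, ?_⟩
    have h1 : (QuotientGroup.mk (Quotient.out (QuotientGroup.mk (⟨h, hh⟩ : H) :
      H ⧸ N.subgroupOf H)) : H ⧸ N.subgroupOf H) = QuotientGroup.mk ⟨h, hh⟩ :=
      QuotientGroup.out_eq' _
    rw [QuotientGroup.eq] at h1
    exact h1

lemma sep_inter {G : Type*} [Group G] {S T : Set G} (hS : SeparableSubset S)
    (hT : SeparableSubset T) : SeparableSubset (S ∩ T) := by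
  intro g hg
  by_cases h : g ∈ S
  · obtain ⟨N, a, b, c⟩ := hT g (fun h' => hg ⟨h, h'⟩)
    exact ⟨N, a, b, fun x hx h' => c x hx h'.2⟩
  · obtain ⟨N, a, b, c⟩ := hS g h
    exact ⟨N, a, b, fun x hx h' => c x hx h'.1⟩

lemma sep_biUnion {G ι : Type*} [Group G] {F : Set ι} (hF : F.Finite) (S : ι → Set G)
    (hS : ∀ i, SeparableSubset (S i)) : SeparableSubset (⋃ i ∈ F, S i) := by
  induction F, hF using Set.Finite.induction_on with
  | empty =>
    intro g _
    exact ⟨⊤, inferInstance, inferInstance, by simp⟩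
  | insert _ _ ih =>
    rw [Set.biUnion_insert]
    intro g hg
    rw [Set.mem_union, not_or] at hg
    obtain ⟨N, a, b, c⟩ := hS _ g hg.1
    obtain ⟨M, a', b', c'⟩ := ih g hg.2
    refine ⟨N ⊓ M, inferInstance, inferInstance, fun x hx h => ?_⟩
    rcases h with h | h
    · exact c x hx.1 h
    · exact c' x hx.2 h

lemma sep_translate {G : Type*} [Group G] {S : Set G} (hS : SeparableSubset S) (a b : G) :
    SeparableSubset {x | a * x * b ∈ S} := by
  intro g hg
  obtain ⟨N, n, i, c⟩ := hS _ hg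
  refine ⟨N, n, i, fun x hx h => ?_⟩
  refine c (b⁻¹ * x * b) (by simpa using n.conj_mem x hx b⁻¹) ?_
  have e : a * g * b * (b⁻¹ * x * b) = a * (g * x) * b := by group
  rw [e]
  exact h

lemma sep_fin {G : Type*} [Group G] (N : Subgroup G) (hN : N.FiniteIndex) :
    SeparableSubset (N : Set G) := by
  intro g hg
  refine ⟨N.normalCore, inferInstance, inferInstance, fun x hx h => hg ?_⟩
  exact (Subgroup.mul_mem_cancel_right N (N.normalCore_le hx)).mp h

lemma sep_preimage {G G' : Type*} [Group G] [Group G'] (f : G →* G') {S : Set G'}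
    (hS : SeparableSubset S) : SeparableSubset (f ⁻¹' S) := by
  intro g hg
  obtain ⟨N, n, i, c⟩ := hS _ hg
  refine ⟨N.comap f, inferInstance, ⟨fun h0 => i.index_ne_zero (by
    rw [Subgroup.index_comap] at h0
    exact Subgroup.index_eq_zero_of_relIndex_eq_zero h0)⟩, fun x hx h => c (f x) hx ?_⟩
  rw [← map_mul]
  exact h

lemma mem_pre {G : Type*} [Group G] {Z : Subgroup G} [Z.Normal] (H K : Subgroup G) (x : G) :
    x ∈ (QuotientGroup.mk' Z) ⁻¹' (((H.map (QuotientGroup.mk' Z) : Subgroup (G ⧸ Z)) : Set (G ⧸ Z))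
      * ((K.map (QuotientGroup.mk' Z) : Subgroup (G ⧸ Z)) : Set (G ⧸ Z))) ↔
    ∃ h ∈ H, ∃ k ∈ K, ∃ z ∈ Z, x = h * k * z := by
  rw [Set.mem_preimage, Set.mem_mul]
  constructor
  · rintro ⟨_, ⟨h, hh, rfl⟩, _, ⟨k, hk, rfl⟩, e⟩
    rw [← map_mul] at e
    refine ⟨h, hh, k, hk, (h * k)⁻¹ * x, QuotientGroup.eq.mp e, by group⟩
  · rintro ⟨h, hh, k, hk, z, hz, rfl⟩
    refine ⟨_, ⟨h, hh, rfl⟩, _, ⟨k, hk, rfl⟩, ?_⟩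
    rw [← map_mul]
    exact QuotientGroup.eq.mpr (by simpa [mul_assoc] using hz)

/-- The central elements of `HK`. -/
def centralPart {G : Type*} [Group G] (Z H K : Subgroup G) (hZ : Z ≤ Subgroup.center G) :
    Subgroup G where
  carrier := {z | z ∈ Z ∧ ∃ h ∈ H, ∃ k ∈ K, z = h * k}
  one_mem' := ⟨Z.one_mem, 1, H.one_mem, 1, K.one_mem, by simp⟩
  mul_mem' := by
    rintro a b ⟨ha, h1, hh1, k1, hk1, e1⟩ ⟨hb, h2, hh2, k2, hk2, e2⟩
    refine ⟨Z.mul_mem ha hb, h1 * h2, H.mul_mem hh1 hh2, k2 * k1, K.mul_mem hk2 hk1, ?_⟩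
    have c : k1 * b = b * k1 := Subgroup.mem_center_iff.mp (hZ hb) k1
    rw [e1, mul_assoc, c, e2]
    group
  inv_mem' := by
    rintro a ⟨ha, h, hh, k, hk, e⟩
    refine ⟨Z.inv_mem ha, h⁻¹, H.inv_mem hh, k⁻¹, K.inv_mem hk, ?_⟩
    have c : k * a = a * k := Subgroup.mem_center_iff.mp (hZ ha) k
    have c2 : a = k * h := by
      have : a * k = (k * h) * k := by rw [← c, e]; group
      exact mul_right_cancel this
    rw [c2]
    group

/-- A group `G` with a finitely generated central subgroup `Z` such that
`G/Z` is double coset separable is double coset separable iff it is subgroup separable. -/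
theorem central_ext_double_coset_separable_iff_subgroup_separable
    (G : Type*) [Group G] (Z : Subgroup G) (hZle : Z ≤ Subgroup.center G) (hZfg : Z.FG)
    (hQ : letI : Z.Normal := normal_of_le_center hZle
      DoubleCosetSeparable (G ⧸ Z)) :
    DoubleCosetSeparable G ↔ SubgroupSeparable G := by
  haveI hn : Z.Normal := normal_of_le_center hZle
  have hQ' : DoubleCosetSeparable (G ⧸ Z) := hQ
  constructor
  · intro h H hH
    have := h H ⊥ hH Subgroup.FG.bot
    simpa using this
  intro hS H K hH hK g hg
  have hpre : ∀ H K : Subgroup G, H.FG → K.FG → SeparableSubset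
      ((QuotientGroup.mk' Z) ⁻¹' (((H.map (QuotientGroup.mk' Z) : Subgroup (G ⧸ Z)) : Set (G ⧸ Z))
      * ((K.map (QuotientGroup.mk' Z) : Subgroup (G ⧸ Z)) : Set (G ⧸ Z)))) := fun H K hH hK =>
    sep_preimage _ (hQ' _ _ (sg_fg_map _ hH) (sg_fg_map _ hK))
  have cen : ∀ z ∈ Z, ∀ x, x * z = z * x := fun z hz x => Subgroup.mem_center_iff.mp (hZle hz) x
  by_cases hgZ : ∃ h ∈ H, ∃ k ∈ K, ∃ z ∈ Z, g = h * k * z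
  swap
  · obtain ⟨N, n, i, c⟩ := hpre H K hH hK g (fun h => hgZ ((mem_pre H K g).mp h))
    refine ⟨N, n, i, fun x hx h => c x hx ((mem_pre H K _).mpr ?_)⟩
    obtain ⟨h, hh, k, hk, e⟩ := Set.mem_mul.mp h
    exact ⟨h, hh, k, hk, 1, Z.one_mem, by rw [← e]; simp⟩
  obtain ⟨h, hh, k, hk, z, hz, rfl⟩ := hgZ
  set A := centralPart Z H K hZle with hAdef
  have hAZ : A ≤ Z := fun a ha => ha.1
  have hzA : z ∉ A := by
    rintro ⟨-, h1, hh1, k1, hk1, e⟩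
    apply hg
    refine Set.mem_mul.mpr ⟨h * h1, H.mul_mem hh hh1, k1 * k, K.mul_mem hk1 hk, ?_⟩
    rw [mul_assoc h k z, cen z hz, e]
    group
  obtain ⟨N, hNn, hNi, hNz⟩ := hS A (central_sub_fg hZle hZfg hAZ) z hzA
  have hzAN : z ∉ A ⊔ N := by
    intro hm
    obtain ⟨a, ha, n, hn, e⟩ := Subgroup.mem_sup_of_normal_right.mp hm
    refine hNz n⁻¹ (N.inv_mem hn) ?_
    rw [← e]
    simpa using ha
  have hANi : (A ⊔ N).FiniteIndex := Subgroup.finiteIndex_of_le (le_sup_right : N ≤ A ⊔ N)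
  have hT := sep_inter (hpre (N ⊓ H) (N ⊓ K) (inf_fin_fg hH hNi) (inf_fin_fg hK hNi))
    (sep_fin (A ⊔ N) hANi)
  set T := ((QuotientGroup.mk' Z) ⁻¹' ((((N ⊓ H).map (QuotientGroup.mk' Z) : Subgroup (G ⧸ Z)) :
      Set (G ⧸ Z)) * (((N ⊓ K).map (QuotientGroup.mk' Z) : Subgroup (G ⧸ Z)) : Set (G ⧸ Z))))
      ∩ ((A ⊔ N : Subgroup G) : Set G) with hTdef
  obtain ⟨F1, hF1, hF1H, hc1⟩ := fin_cosets H N hNi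
  obtain ⟨F2, hF2, hF2K, hc2⟩ := fin_cosets K N hNi
  have hU : SeparableSubset (⋃ a ∈ F1, ⋃ b ∈ F2, {x | a⁻¹ * x * b ∈ T}) :=
    sep_biUnion hF1 _ fun a => sep_biUnion hF2 _ fun b => sep_translate hT _ _
  have hsub : (H : Set G) * (K : Set G) ⊆ ⋃ a ∈ F1, ⋃ b ∈ F2, {x | a⁻¹ * x * b ∈ T} := by
    intro x hx
    obtain ⟨h1, hh1, k1, hk1, rfl⟩ := Set.mem_mul.mp hx
    obtain ⟨a, ha, ha'⟩ := hc1 h1 hh1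
    obtain ⟨b, hb, hb'⟩ := hc2 k1⁻¹ (K.inv_mem hk1)
    have hb'' : k1 * b ∈ N := by simpa using N.inv_mem hb'
    have e : a⁻¹ * (h1 * k1) * b = (a⁻¹ * h1) * (k1 * b) := by group
    simp only [Set.mem_iUnion, Set.mem_setOf_eq]
    refine ⟨a, ha, b, hb, ?_⟩
    rw [e]
    refine ⟨(mem_pre _ _ _).mpr ⟨a⁻¹ * h1, ⟨ha', H.mul_mem (H.inv_mem (hF1H ha)) hh1⟩, k1 * b,
      ⟨hb'', K.mul_mem hk1 (hF2K hb)⟩, 1, Z.one_mem, by simp⟩, ?_⟩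
    exact (le_sup_right : N ≤ A ⊔ N) (N.mul_mem ha' hb'')
  have hgU : h * k * z ∉ ⋃ a ∈ F1, ⋃ b ∈ F2, {x | a⁻¹ * x * b ∈ T} := by
    simp only [Set.mem_iUnion, Set.mem_setOf_eq]
    rintro ⟨a, ha, b, hb, ht1, ht2⟩
    obtain ⟨h1, hh1, k1, hk1, w, hw, e⟩ := (mem_pre _ _ _).mp ht1
    have hwAN : w ∈ A ⊔ N := by
      rw [e] at ht2
      exact (Subgroup.mul_mem_cancel_left _
        ((le_sup_right : N ≤ A ⊔ N) (N.mul_mem hh1.1 hk1.1))).mp ht2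
    have hA : z * w⁻¹ ∈ A := by
      refine ⟨Z.mul_mem hz (Z.inv_mem hw), h⁻¹ * (a * h1),
        H.mul_mem (H.inv_mem hh) (H.mul_mem (hF1H ha) hh1.2), k1 * b⁻¹ * k⁻¹,
        K.mul_mem (K.mul_mem hk1.2 (K.inv_mem (hF2K hb))) (K.inv_mem hk), ?_⟩
      have e2 : h1 * k1 = a⁻¹ * (h * k * z) * b * w⁻¹ := by rw [e]; group
      have e3 : h⁻¹ * (a * h1) * (k1 * b⁻¹ * k⁻¹) = h⁻¹ * a * (h1 * k1) * b⁻¹ * k⁻¹ := by group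
      have c1 := cen w⁻¹ (Z.inv_mem hw)
      rw [e3, e2, c1 (a⁻¹ * (h * k * z) * b), mul_assoc h k z, cen z hz k]
      have e4 : h⁻¹ * a * (w⁻¹ * (a⁻¹ * (h * (z * k)) * b)) * b⁻¹ * k⁻¹ =
        ((h⁻¹ * a) * w⁻¹) * (a⁻¹ * (h * z)) := by group
      rw [e4, c1 (h⁻¹ * a), cen z hz h]
      have e5 : w⁻¹ * (h⁻¹ * a) * (a⁻¹ * (z * h)) = w⁻¹ * (h⁻¹ * z) * h := by group
      rw [e5, cen z hz h⁻¹, c1 z]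
      group
    apply hzAN
    have := (A ⊔ N).mul_mem ((le_sup_left : A ≤ A ⊔ N) hA) hwAN
    simpa using this
  obtain ⟨M, m, i, c⟩ := hU _ hgU
  exact ⟨M, m, i, fun x hx hm => c x hx (hsub hm)⟩
end

section
/- Let G be a double coset separable group and let N be a finitely generated nilpotent group. Then the direct product G × N is double coset separable. -/
open scoped Pointwise

namespace DCS

lemma fg_map {Γ Γ' : Type*} [Group Γ] [Group Γ'] {H : Subgroup Γ} (hH : H.FG) (f : Γ →* Γ') :
    (H.map f).FG := by
  classical
  obtain ⟨S, rfl⟩ := hH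
  exact ⟨S.image f, by rw [MonoidHom.map_closure]; simp⟩

lemma sep_iUnion {Γ ι : Type*} [Group Γ] [Finite ι] (S : ι → Set Γ)
    (h : ∀ i, SeparableSubset (S i)) : SeparableSubset (⋃ i, S i) := by
  intro g hg
  simp only [Set.mem_iUnion, not_exists] at hg
  choose N hN hf hx using fun i => h i g (hg i)
  refine ⟨⨅ i, N i, Subgroup.normal_iInf_normal hN, Subgroup.finiteIndex_iInf hf, ?_⟩
  intro x hx' hmem
  obtain ⟨i, hi⟩ := Set.mem_iUnion.1 hmem
  exact hx i x ((Subgroup.mem_iInf.1 hx') i) hi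

lemma sep_translate {Γ : Type*} [Group Γ] {S : Set Γ} (h : SeparableSubset S) (a b : Γ) :
    SeparableSubset {x | a * x * b ∈ S} := by
  intro g hg
  obtain ⟨N, hN, hf, hx⟩ := h _ hg
  refine ⟨N, hN, hf, fun x hxN hmem => ?_⟩
  refine hx (b⁻¹ * x * b) ?_ ?_
  · simpa using hN.conj_mem x hxN b⁻¹
  · have : a * g * b * (b⁻¹ * x * b) = a * (g * x) * b := by group
    rw [this]; exact hmem

lemma sep_comap {Γ Γ' : Type*} [Group Γ] [Group Γ'] (f : Γ →* Γ') {S : Set Γ'}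
    (h : SeparableSubset S) : SeparableSubset (f ⁻¹' S) := by
  intro g hg
  obtain ⟨N, hN, hf, hx⟩ := h _ hg
  have hfi : (N.comap f).FiniteIndex := by
    have : N.comap f = ((QuotientGroup.mk' N).comp f).ker := by
      rw [← MonoidHom.comap_ker, QuotientGroup.ker_mk']
    rw [this]
    infer_instance
  refine ⟨N.comap f, inferInstance, hfi, fun x hxN hmem => ?_⟩
  refine hx (f x) hxN ?_
  rw [← map_mul]; exact hmem

lemma sep_inl {G F : Type*} [Group G] [Group F] [Finite F] {S : Set G}
    (h : SeparableSubset S) : SeparableSubset {x : G × F | x.1 ∈ S ∧ x.2 = 1} := by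
  intro g hg
  by_cases h2 : g.2 = 1
  · have h1 : g.1 ∉ S := fun h1 => hg ⟨h1, h2⟩
    obtain ⟨N, hN, hf, hx⟩ := sep_comap (MonoidHom.fst G F) h g h1
    exact ⟨N, hN, hf, fun x hxN hmem => hx x hxN hmem.1⟩
  · refine ⟨(MonoidHom.snd G F).ker, inferInstance, inferInstance, fun x hxN hmem => ?_⟩
    have : x.2 = 1 := hxN
    exact h2 (by simpa [this] using hmem.2)

lemma fg_comap_inl {G F : Type*} [Group G] [Group F] [Finite F] (H : Subgroup (G × F))
    (hH : H.FG) : (H.comap (MonoidHom.inl G F)).FG := by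
  have : Group.FG H := (Group.fg_iff_subgroup_fg H).2 hH
  let f : H →* F := (MonoidHom.snd G F).comp H.subtype
  have : f.ker.FiniteIndex := inferInstance
  have h1 : f.ker.FG := (Group.fg_iff_subgroup_fg _).1 (Subgroup.fg_of_index_ne_zero f.ker)
  have h2 := fg_map h1 ((MonoidHom.fst G F).comp H.subtype)
  convert h2 using 1
  ext x
  simp only [Subgroup.mem_comap, Subgroup.mem_map, MonoidHom.mem_ker]
  constructor
  · intro hx
    exact ⟨⟨_, hx⟩, rfl, rfl⟩
  · rintro ⟨⟨⟨a, b⟩, hab⟩, h1, h2⟩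
    have h1 : b = 1 := h1
    have h2 : a = x := h2
    subst h1 h2
    exact hab

lemma dcs_prod_finite {G F : Type*} [Group G] [Group F] [Finite F]
    (hG : DoubleCosetSeparable G) : DoubleCosetSeparable (G × F) := by
  intro H K hH hK
  have h0 := sep_inl (F := F) (hG _ _ (fg_comap_inl H hH) (fg_comap_inl K hK))
  let ι := {p : (G × F) × (G × F) // p.1 ∈ H ∧ p.2 ∈ K}
  have key : ∀ a b : F, ∃ T : Set (G × F), SeparableSubset T ∧
      T ⊆ (H : Set (G × F)) * (K : Set (G × F)) ∧
      ∀ h ∈ H, ∀ k ∈ K, h.2 = a → k.2 = b → h * k ∈ T := by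
    intro a b
    by_cases hab : ∃ h ∈ H, ∃ k ∈ K, h.2 = a ∧ k.2 = b
    · obtain ⟨h, hh, k, hk, rfl, rfl⟩ := hab
      refine ⟨_, sep_translate h0 h⁻¹ k⁻¹, ?_, ?_⟩
      · rintro x ⟨hx1, hx2⟩
        obtain ⟨u, hu, v, hv, huv⟩ := Set.mem_mul.1 hx1
        refine Set.mem_mul.2 ⟨h * (u, 1), H.mul_mem hh hu, (v, 1) * k, K.mul_mem hv hk, ?_⟩
        have : h⁻¹ * x * k⁻¹ = (u, 1) * (v, 1) := by
          ext
          · exact huv.symm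
          · simpa using hx2
        calc h * (u, 1) * ((v, 1) * k) = h * ((u, 1) * (v, 1)) * k := by group
          _ = x := by rw [← this]; group
      · intro h' hh' k' hk' e1 e2
        refine ⟨Set.mem_mul.2 ⟨(h⁻¹ * h').1, ?_, (k' * k⁻¹).1, ?_, ?_⟩, ?_⟩
        · have := H.mul_mem (H.inv_mem hh) hh'
          have e : h⁻¹ * h' = ((h⁻¹ * h').1, 1) := by ext <;> simp [e1]
          rw [e] at this; exact this
        · have := K.mul_mem hk' (K.inv_mem hk)
          have e : k' * k⁻¹ = ((k' * k⁻¹).1, 1) := by ext <;> simp [e2]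
          rw [e] at this; exact this
        · simp [mul_assoc]
        · simp [e1, e2, mul_assoc]
    · refine ⟨∅, fun g _ => ⟨⊤, inferInstance, inferInstance, by simp⟩, by simp, ?_⟩
      intro h hh k hk e1 e2
      exact absurd ⟨h, hh, k, hk, e1, e2⟩ hab
  choose T hT1 hT2 hT3 using key
  have : (H : Set (G × F)) * (K : Set (G × F)) = ⋃ p : F × F, T p.1 p.2 := by
    apply Set.Subset.antisymm
    · rintro x hx
      obtain ⟨h, hh, k, hk, rfl⟩ := Set.mem_mul.1 hx
      exact Set.mem_iUnion.2 ⟨(h.2, k.2), hT3 _ _ h hh k hk rfl rfl⟩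
    · exact Set.iUnion_subset fun p => hT2 _ _
  rw [this]
  exact sep_iUnion _ fun p => hT1 _ _

lemma torsion_center_quot {N : Type*} [Group N] [Group.FG N]
    (h : ∀ x ∈ Subgroup.center N, IsOfFinOrder x) :
    ∀ x ∈ Subgroup.center (N ⧸ Subgroup.center N), IsOfFinOrder x := by
  intro x hx
  obtain ⟨x, rfl⟩ := QuotientGroup.mk_surjective x
  obtain ⟨S, hS⟩ := Group.fg_def.1 ‹Group.FG N›
  have hc : ∀ n : N, (x * n)⁻¹ * (n * x) ∈ Subgroup.center N := by
    intro n
    rw [← QuotientGroup.eq]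
    exact (Subgroup.mem_center_iff.1 hx n).symm
  have hpow : ∀ n : N, ∀ e : ℕ, n * x ^ e = x ^ e * n * ((x * n)⁻¹ * (n * x)) ^ e := by
    intro n e
    induction e with
    | zero => simp
    | succ e ih =>
      have hz := Subgroup.mem_center_iff.1 ((Subgroup.center N).pow_mem (hc n) e)
      rw [pow_succ x, ← mul_assoc, ih, mul_assoc _ _ x, ← hz x, pow_succ']
      have : n * x = x * n * ((x * n)⁻¹ * (n * x)) := by group
      rw [← mul_assoc, mul_assoc _ n x]
      nth_rewrite 1 [this]
      simp only [mul_assoc]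
  let e := ∏ n ∈ S, orderOf ((x * n)⁻¹ * (n * x))
  have he : 0 < e := Finset.prod_pos fun n _ => (h _ (hc n)).orderOf_pos
  have hcen : x ^ e ∈ Subgroup.center N := by
    have : (⊤ : Subgroup N) ≤ Subgroup.centralizer {x ^ e} := by
      rw [← hS, Subgroup.closure_le]
      intro n hn
      have h1 : ((x * n)⁻¹ * (n * x)) ^ e = 1 :=
        orderOf_dvd_iff_pow_eq_one.1 (Finset.dvd_prod_of_mem _ hn)
      have h2 := hpow n e
      rw [h1, mul_one] at h2
      simp only [SetLike.mem_coe, Subgroup.mem_centralizer_singleton_iff]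
      exact h2
    rw [Subgroup.mem_center_iff]
    intro g
    exact Subgroup.mem_centralizer_singleton_iff.1 (this (Subgroup.mem_top g))
  refine isOfFinOrder_iff_pow_eq_one.2 ⟨e, he, ?_⟩
  rw [← QuotientGroup.mk_pow]
  exact (QuotientGroup.eq_one_iff _).2 hcen

lemma finite_of_torsion_center {N : Type*} [Group N] (hn : Group.IsNilpotent N) :
    Group.FG N → (∀ x ∈ Subgroup.center N, IsOfFinOrder x) → Finite N := by
  refine Group.nilpotent_center_quotient_ind
    (P := fun N _ _ => Group.FG N → (∀ x ∈ Subgroup.center N, IsOfFinOrder x) → Finite N) N ?_ ?_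
  · intros; infer_instance
  · intro G _ _ ih hfg h
    have h1 : Finite (G ⧸ Subgroup.center G) := ih inferInstance (torsion_center_quot h)
    have h2 : (Subgroup.center G).FiniteIndex := Subgroup.finiteIndex_of_finite_quotient
    have h3 : Group.FG (Subgroup.center G) := Subgroup.fg_of_index_ne_zero _
    let _ : CommGroup (Subgroup.center G) :=
      { (inferInstance : Group (Subgroup.center G)) with
        mul_comm := fun a b => Subtype.ext (Subgroup.mem_center_iff.1 b.2 a) }
    have h4 : Finite (Subgroup.center G) := CommGroup.finite_of_fg_isMulTorsion _ (by
      intro x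
      have := h x x.2
      exact Submonoid.isOfFinOrder_coe.1 this)
    exact Finite.of_subgroup_quotient (Subgroup.center G)

/-- The maximality condition forces the centre to be torsion. -/
lemma torsion_center {G N : Type*} [Group G] [Group N] (H K : Subgroup (G × N)) (g : G × N)
    (hg : g ∉ (H : Set (G × N)) * (K : Set (G × N)))
    (hmax : ∀ B : Subgroup N, B.Normal → B ≠ ⊥ →
      ∃ b ∈ B, g * (1, b) ∈ (H : Set (G × N)) * (K : Set (G × N))) :
    ∀ x ∈ Subgroup.center N, IsOfFinOrder x := by
  intro x hx
  by_contra hinf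
  -- elements of the centre lying in the product
  have hcomm : ∀ z ∈ Subgroup.center N, ∀ w : G × N, w * (1, z) = (1, z) * w := by
    intro z hz w
    ext
    · simp
    · exact Subgroup.mem_center_iff.1 hz w.2
  let A : Subgroup N :=
    { carrier := {z | z ∈ Subgroup.center N ∧
        ((1, z) : G × N) ∈ (H : Set (G × N)) * (K : Set (G × N))}
      one_mem' := ⟨Subgroup.one_mem _, Set.mem_mul.2 ⟨1, H.one_mem, 1, K.one_mem, one_mul _⟩⟩
      mul_mem' := by
        rintro a b ⟨ha, ha'⟩ ⟨hb, hb'⟩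
        obtain ⟨h, hh, k, hk, e⟩ := Set.mem_mul.1 ha'
        obtain ⟨h', hh', k', hk', e'⟩ := Set.mem_mul.1 hb'
        refine ⟨Subgroup.mul_mem _ ha hb,
          Set.mem_mul.2 ⟨h * h', H.mul_mem hh hh', k' * k, K.mul_mem hk' hk, ?_⟩⟩
        calc h * h' * (k' * k) = h * (h' * k') * k := by group
          _ = (1, b) * (h * k) := by rw [e', hcomm b hb]; group
          _ = (1, a * b) := by
            rw [e, ← hcomm b hb]; simp
      inv_mem' := by
        rintro a ⟨ha, ha'⟩
        obtain ⟨h, hh, k, hk, e⟩ := Set.mem_mul.1 ha'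
        refine ⟨Subgroup.inv_mem _ ha,
          Set.mem_mul.2 ⟨h⁻¹, H.inv_mem hh, k⁻¹, K.inv_mem hk, ?_⟩⟩
        have e2 : h = (1, a) * k⁻¹ := by rw [← e]; group
        have : ((1, a⁻¹) : G × N) = (1, a)⁻¹ := by simp
        rw [this, e2, ← hcomm a ha]
        group }
  have hz : ∀ y ∈ Subgroup.center N, y ≠ 1 → ∃ n : ℤ,
      g * (1, y ^ n) ∈ (H : Set (G × N)) * (K : Set (G × N)) := by
    intro y hy hy1
    obtain ⟨b, hb, hb'⟩ := hmax (Subgroup.zpowers y)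
      (normal_of_le_center (Subgroup.zpowers_le.2 hy)) (by simpa using hy1)
    obtain ⟨n, rfl⟩ := Subgroup.mem_zpowers_iff.1 hb
    exact ⟨n, hb'⟩
  have hpow : ∀ n : ℤ, x ^ n = 1 → n = 0 := by
    intro n hn
    by_contra h0
    exact hinf (isOfFinOrder_iff_zpow_eq_one.2 ⟨n, h0, hn⟩)
  have hxn : ∀ n : ℤ, x ^ n ∈ Subgroup.center N := fun n => Subgroup.zpow_mem _ hx n
  obtain ⟨n, hn⟩ := hz x hx (fun h => by simpa using hpow 1 (by simpa using h))
  obtain ⟨h, hh, k, hk, e⟩ := Set.mem_mul.1 hn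
  -- translate from `g` to `x ^ (-n)`
  have ge : g = h * (1, x ^ (-n)) * k := by
    rw [hcomm _ (hxn _), mul_assoc, e, ← hcomm _ (hxn _), mul_assoc]; simp
  have htr : ∀ m : ℤ, g * (1, x ^ m) ∈ (H : Set (G × N)) * (K : Set (G × N)) ↔
      x ^ (m - n) ∈ A := by
    intro m
    have e3 : g * (1, x ^ m) = h * (1, x ^ (m - n)) * k := by
      have e4 : ((1, x ^ (m - n)) : G × N) = (1, x ^ (-n)) * (1, x ^ m) := by
        rw [Prod.mk_mul_mk, ← zpow_add, one_mul, sub_eq_neg_add]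
      rw [ge, e4, mul_assoc _ k, hcomm _ (hxn m) k]
      simp only [mul_assoc]
    rw [e3]
    constructor
    · intro hm
      obtain ⟨h', hh', k', hk', e'⟩ := Set.mem_mul.1 hm
      refine ⟨hxn _, Set.mem_mul.2 ⟨h⁻¹ * h', H.mul_mem (H.inv_mem hh) hh', k' * k⁻¹,
        K.mul_mem hk' (K.inv_mem hk), ?_⟩⟩
      calc h⁻¹ * h' * (k' * k⁻¹) = h⁻¹ * (h' * k') * k⁻¹ := by group
        _ = _ := by rw [e']; group
    · rintro ⟨-, hm⟩
      obtain ⟨h', hh', k', hk', e'⟩ := Set.mem_mul.1 hm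
      refine Set.mem_mul.2 ⟨h * h', H.mul_mem hh hh', k' * k, K.mul_mem hk' hk, ?_⟩
      rw [← e']; group
  have hA : x ^ (-n) ∉ A := by
    intro hA
    refine hg ?_
    have := (htr 0).2 (by simpa using hA)
    have h1 : ((1, 1) : G × N) = 1 := rfl
    simpa [h1] using this
  have hn0 : n ≠ 0 := by
    rintro rfl
    exact hA (by simp)
  obtain ⟨m, hm⟩ := hz (x ^ (2 * n)) (hxn _) (fun h => by have := hpow _ h; omega)
  rw [← zpow_mul, htr] at hm
  have hu : 2 * n * m - n ≠ 0 := by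
    have : 2 * n * m - n = n * (2 * m - 1) := by ring
    rw [this]
    exact mul_ne_zero hn0 (by omega)
  obtain ⟨i, hi⟩ := hz (x ^ (2 * n * m - n)) (hxn _) (fun h => hu (hpow _ h))
  rw [← zpow_mul, htr] at hi
  refine hA ?_
  have := A.mul_mem hi (A.zpow_mem hm (-i))
  rw [← zpow_mul, ← zpow_add] at this
  convert this using 2
  ring

lemma exists_max {G N : Type*} [Group G] [Group N] (S : Set (G × N)) (g : G × N) (hg : g ∉ S) :
    ∃ M : Subgroup N, M.Normal ∧ (∀ m ∈ M, g * (1, m) ∉ S) ∧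
      ∀ B : Subgroup N, B.Normal → M < B → ∃ b ∈ B, g * (1, b) ∈ S := by
  obtain ⟨M, -, hM⟩ := zorn_le_nonempty₀
    {M : Subgroup N | M.Normal ∧ ∀ m ∈ M, g * (1, m) ∉ S} (by
      intro c hc hchain y hy
      have hmem : ∀ x, x ∈ sSup c ↔ ∃ M ∈ c, x ∈ M :=
        fun x => Subgroup.mem_sSup_of_directedOn ⟨y, hy⟩ hchain.directedOn
      refine ⟨sSup c, ⟨⟨?_⟩, ?_⟩, fun z hz => le_sSup hz⟩
      · intro n hn x
        obtain ⟨M, hM, hnM⟩ := (hmem _).1 hn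
        exact (hmem _).2 ⟨M, hM, (hc hM).1.conj_mem _ hnM _⟩
      · intro m hm
        obtain ⟨M, hM, hnM⟩ := (hmem _).1 hm
        exact (hc hM).2 _ hnM) ⊥ ⟨inferInstance, by
      intro m hm
      have h1 : ((1, 1) : G × N) = 1 := rfl
      rw [Subgroup.mem_bot.1 hm, h1, mul_one]; exact hg⟩
  refine ⟨M, hM.prop.1, hM.prop.2, ?_⟩
  intro B hB hlt
  by_contra! hcon
  exact hlt.not_ge (hM.le_of_ge ⟨hB, hcon⟩ hlt.le)

end DCS

/-- the direct product of a double coset separable group with a finitely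
generated nilpotent group is double coset separable. -/
theorem double_coset_separable_prod_nilpotent
    (G N : Type*) [Group G] [Group N] (hG : DoubleCosetSeparable G)
    (hnilp : Group.IsNilpotent N) (hfg : Group.FG N) :
    DoubleCosetSeparable (G × N) := by
  intro H K hH hK g hg
  obtain ⟨M, hMn, hM, hmax⟩ := DCS.exists_max _ g hg
  let π : G × N →* G × (N ⧸ M) := (MonoidHom.id G).prodMap (QuotientGroup.mk' M)
  have hπg : π g ∉ ((H.map π : Subgroup _) : Set (G × (N ⧸ M))) * ((K.map π : Subgroup _) : Set _) := by
    intro hmem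
    obtain ⟨_, ⟨h, hh, rfl⟩, _, ⟨k, hk, rfl⟩, e⟩ := Set.mem_mul.1 hmem
    rw [← map_mul] at e
    have e1 : (h * k).1 = g.1 := congrArg (fun p : G × (N ⧸ M) => p.1) e
    have e2 : (QuotientGroup.mk (h * k).2 : N ⧸ M) = QuotientGroup.mk g.2 := congrArg (fun p : G × (N ⧸ M) => p.2) e
    refine hM (g.2⁻¹ * (h * k).2) (QuotientGroup.eq.1 e2.symm) ?_
    have : g * (1, g.2⁻¹ * (h * k).2) = h * k := by
      ext
      · simpa using e1.symm
      · simp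
    rw [this]
    exact Set.mul_mem_mul hh hk
  have hfin : Finite (N ⧸ M) := by
    refine DCS.finite_of_torsion_center inferInstance inferInstance
      (DCS.torsion_center (H.map π) (K.map π) (π g) hπg ?_)
    intro B hB hB1
    have hle : M ≤ B.comap (QuotientGroup.mk' M) := by
      intro m hm
      have : (QuotientGroup.mk' M) m = 1 := (QuotientGroup.eq_one_iff m).2 hm
      rw [Subgroup.mem_comap, this]
      exact B.one_mem
    have hlt : M < B.comap (QuotientGroup.mk' M) := by
      refine lt_of_le_of_ne hle fun heq => hB1 ?_
      rw [eq_bot_iff]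
      intro b hb
      obtain ⟨b, rfl⟩ := QuotientGroup.mk_surjective b
      have hb' : b ∈ B.comap (QuotientGroup.mk' M) := hb
      rw [← heq] at hb'
      exact Subgroup.mem_bot.2 ((QuotientGroup.eq_one_iff b).2 hb')
    obtain ⟨b, hb, hgb⟩ := hmax _ inferInstance hlt
    refine ⟨QuotientGroup.mk' M b, hb, ?_⟩
    obtain ⟨h, hh, k, hk, e⟩ := Set.mem_mul.1 hgb
    refine Set.mem_mul.2 ⟨π h, Subgroup.mem_map_of_mem _ hh, π k, Subgroup.mem_map_of_mem _ hk, ?_⟩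
    rw [← map_mul]
    have e' : h * k = g * (1, b) := e
    rw [e', map_mul]
    rfl
  have hsep := DCS.sep_comap π
    (DCS.dcs_prod_finite (F := N ⧸ M) hG (H.map π) (K.map π) (DCS.fg_map hH π) (DCS.fg_map hK π))
  obtain ⟨L, hL, hLf, hx⟩ := hsep g hπg
  refine ⟨L, hL, hLf, fun x hxL hmem => hx x hxL ?_⟩
  obtain ⟨h, hh, k, hk, e⟩ := Set.mem_mul.1 hmem
  refine Set.mem_mul.2 ⟨π h, Subgroup.mem_map_of_mem _ hh, π k, Subgroup.mem_map_of_mem _ hk, ?_⟩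
  rw [← map_mul]
  exact congrArg π e
end

section
/- Let G be a group and let Z be a finitely generated subgroup of the center of G, and set Q = G/Z. Suppose that Q is product separable, that G is subgroup separable, and that Q has bottlenecked product representatives over the class of all finitely generated subgroups of Q. Then G is product separable. -/
open scoped Pointwise

namespace CExt

/-- product set of a list of subgroups -/
def PS {G : Type*} [Group G] (l : List (Subgroup G)) : Set G :=
  (l.map (fun H : Subgroup G => (H : Set G))).prod

section
variable {G : Type*} [Group G]

lemma fgmap {Q : Type*} [Group Q] {H : Subgroup G} (h : H.FG) (φ : G →* Q) :
    (H.map φ).FG := by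
  rw [Subgroup.fg_iff_submonoid_fg] at h ⊢
  exact h.map φ

lemma PS_nil : PS ([] : List (Subgroup G)) = {1} := rfl

lemma PS_cons (H : Subgroup G) (l) : PS (H :: l) = (H : Set G) * PS l := by simp [PS]

lemma PS_append (l l' : List (Subgroup G)) : PS (l ++ l') = PS l * PS l' := by simp [PS]

lemma mem_PS_cons {H : Subgroup G} {l} {x : G} :
    x ∈ PS (H :: l) ↔ ∃ h ∈ H, ∃ y ∈ PS l, h * y = x := by
  rw [PS_cons, Set.mem_mul]; rfl

lemma mem_PS_map {ι : Type*} (L : List ι) (H : ι → Subgroup G) (h : ι → G)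
    (hh : ∀ i, h i ∈ H i) : (L.map h).prod ∈ PS (L.map H) := by
  induction L with
  | nil => simp [PS]
  | cons a L ih =>
    rw [List.map_cons, mem_PS_cons]
    exact ⟨_, hh a, _, ih, by simp⟩

lemma sep_empty : SeparableSubset (∅ : Set G) :=
  fun _ _ => ⟨⊤, inferInstance, inferInstance, fun _ _ h => h⟩

lemma sep_union {A B : Set G} (hA : SeparableSubset A) (hB : SeparableSubset B) :
    SeparableSubset (A ∪ B) := by
  intro g hg
  obtain ⟨N, h1, h2, h3⟩ := hA g (fun h => hg (Or.inl h))
  obtain ⟨M, k1, k2, k3⟩ := hB g (fun h => hg (Or.inr h))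
  refine ⟨N ⊓ M, inferInstance, inferInstance, ?_⟩
  rintro x ⟨hx, hx'⟩ (h | h)
  · exact h3 x hx h
  · exact k3 x hx' h

lemma sep_biUnion {ι : Type*} {F : Set ι} (hF : F.Finite) (S : ι → Set G)
    (h : ∀ i ∈ F, SeparableSubset (S i)) : SeparableSubset (⋃ i ∈ F, S i) := by
  induction F, hF using Set.Finite.induction_on with
  | empty => simpa using sep_empty
  | insert _ _ ih =>
    rw [Set.biUnion_insert]
    exact sep_union (h _ (by simp)) (ih fun i hi => h i (by simp [hi]))

lemma sep_inter {A B : Set G} (hA : SeparableSubset A) (hB : SeparableSubset B) :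
    SeparableSubset (A ∩ B) := by
  intro g hg
  by_cases h : g ∈ A
  · obtain ⟨M, k1, k2, k3⟩ := hB g (fun h' => hg ⟨h, h'⟩)
    exact ⟨M, k1, k2, fun x hx h => k3 x hx h.2⟩
  · obtain ⟨M, k1, k2, k3⟩ := hA g h
    exact ⟨M, k1, k2, fun x hx h => k3 x hx h.1⟩

lemma sep_left {A : Set G} (hA : SeparableSubset A) (a : G) :
    SeparableSubset ({a} * A) := by
  intro g hg
  obtain ⟨M, k1, k2, k3⟩ := hA (a⁻¹ * g) (fun h => hg ⟨a, rfl, _, h, by simp⟩)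
  refine ⟨M, k1, k2, ?_⟩
  rintro x hx ⟨a', ha', y, hy, e⟩
  obtain rfl : a' = a := ha'
  apply k3 x hx
  have : a'⁻¹ * g * x = y := by rw [mul_assoc, ← e]; simp
  rwa [this]

lemma sep_preimage {Q : Type*} [Group Q] (φ : G →* Q) {A : Set Q} (hA : SeparableSubset A) :
    SeparableSubset (φ ⁻¹' A) := by
  intro g hg
  obtain ⟨M, k1, k2, k3⟩ := hA (φ g) hg
  refine ⟨M.comap φ, inferInstance, ⟨?_⟩, ?_⟩
  · rw [Subgroup.index_comap]
    exact (Subgroup.instFiniteIndex_subgroupOf M φ.range).index_ne_zero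
  intro x hx h
  apply k3 _ hx
  simpa using h

lemma sep_normal (M : Subgroup G) [hM : M.Normal] [hf : M.FiniteIndex] :
    SeparableSubset (M : Set G) := by
  intro g hg
  refine ⟨M, hM, hf, fun x hx h => hg ?_⟩
  exact (Subgroup.mul_mem_cancel_right M hx).1 h

lemma map_PS {Q : Type*} [Group Q] (φ : G →* Q) (l : List (Subgroup G)) :
    φ '' PS l = PS (l.map (Subgroup.map φ)) := by
  induction l with
  | nil => rw [List.map_nil, PS_nil, PS_nil]; simp
  | cons a l ih => rw [List.map_cons, PS_cons, PS_cons, ← ih, Set.image_mul]; simp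

/-- conjugate `a⁻¹ H a` -/
def cj (a : G) (H : Subgroup G) : Subgroup G := H.map (MulAut.conj a⁻¹).toMonoidHom

lemma cj_PS (a : G) (l : List (Subgroup G)) {x : G} :
    x ∈ PS l ↔ a⁻¹ * x * a ∈ PS (l.map (cj a)) := by
  have := map_PS (MulAut.conj a⁻¹).toMonoidHom l
  change _ = PS (l.map (cj a)) at this
  rw [← this]
  constructor
  · intro h; exact ⟨x, h, by simp⟩
  · rintro ⟨y, hy, e⟩
    simp at e
    rwa [← e]

lemma mem_cj {a : G} {H : Subgroup G} {x : G} : x ∈ cj a H ↔ a * x * a⁻¹ ∈ H := by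
  constructor
  · rintro ⟨y, hy, rfl⟩
    simpa [mul_assoc] using hy
  · intro h; exact ⟨_, h, by simp [mul_assoc]⟩

lemma cj_FG {a : G} {H : Subgroup G} (h : H.FG) : (cj a H).FG := fgmap h _

lemma fg_inf_finiteIndex {H : Subgroup G} (hH : H.FG) (M : Subgroup G) [M.FiniteIndex] :
    (H ⊓ M).FG := by
  have : Group.FG H := (Group.fg_iff_subgroup_fg H).2 hH
  have h1 : (M.subgroupOf H).FG := (Group.fg_iff_subgroup_fg _).1 inferInstance
  have := fgmap h1 H.subtype
  rwa [Subgroup.subgroupOf_map_subtype, inf_comm] at this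

lemma finite_cover (H M : Subgroup G) [M.FiniteIndex] :
    ∃ F : Set G, F.Finite ∧ F ⊆ H ∧ ∀ h ∈ H, ∃ a ∈ F, a⁻¹ * h ∈ H ⊓ M := by
  let f : H → G ⧸ M := fun h => ((h : G) : G ⧸ M)
  have hfin : (Set.range f).Finite := Set.toFinite _
  choose r hr using fun y : Set.range f => y.2
  have := hfin.to_subtype
  refine ⟨Set.range (fun y => (r y : G)), Set.finite_range _, ?_, ?_⟩
  · rintro _ ⟨y, rfl⟩; exact (r y).2
  · intro h hh
    refine ⟨_, ⟨⟨f ⟨h, hh⟩, ⟨_, rfl⟩⟩, rfl⟩, ?_, ?_⟩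
    · exact H.mul_mem (H.inv_mem (r _).2) hh
    · exact QuotientGroup.eq.1 (hr ⟨f ⟨h, hh⟩, ⟨_, rfl⟩⟩)

lemma decomp (M : Subgroup G) [M.Normal] [M.FiniteIndex] (l : List (Subgroup G))
    (hl : ∀ H ∈ l, H.FG) :
    ∃ F : Set (G × List (Subgroup G)), F.Finite ∧
      (∀ p ∈ F, ∀ H ∈ p.2, H.FG ∧ H ≤ M) ∧ PS l = ⋃ p ∈ F, {p.1} * PS p.2 := by
  induction l with
  | nil =>
    refine ⟨{(1, [])}, by simp, by simp, ?_⟩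
    simp [PS]
  | cons H l ih =>
    obtain ⟨F, hF, hF1, hF2⟩ := ih (fun K hK => hl K (by simp [hK]))
    obtain ⟨E, hE, hEH, hE1⟩ := finite_cover H M
    refine ⟨(fun q : G × (G × List (Subgroup G)) =>
      (q.1 * q.2.1, cj q.2.1 (H ⊓ M) :: q.2.2)) '' (E ×ˢ F), (hE.prod hF).image _, ?_, ?_⟩
    · rintro _ ⟨⟨a, p⟩, ⟨ha, hp⟩, rfl⟩ K hK
      rcases List.mem_cons.1 hK with rfl | hK
      · refine ⟨cj_FG (fg_inf_finiteIndex (hl H (by simp)) M), ?_⟩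
        intro x hx
        have := (mem_cj.1 hx).2
        have := ‹M.Normal›.conj_mem _ this p.1⁻¹
        simpa [mul_assoc] using this
      · exact hF1 p hp K hK
    · ext x
      rw [mem_PS_cons]
      simp only [Set.mem_iUnion, Set.mem_image, exists_prop]
      constructor
      · rintro ⟨h, hh, y, hy, rfl⟩
        rw [hF2] at hy
        simp only [Set.mem_iUnion, exists_prop] at hy
        obtain ⟨p, hp, _, rfl, w, hw, rfl⟩ := hy
        obtain ⟨a, ha, hm⟩ := hE1 h hh
        refine ⟨_, ⟨(a, p), ⟨ha, hp⟩, rfl⟩, _, rfl, (p.1⁻¹ * (a⁻¹ * h) * p.1) * w, ?_, ?_⟩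
        · refine mem_PS_cons.2 ⟨_, ?_, _, hw, rfl⟩
          rw [mem_cj]; simpa [mul_assoc] using hm
        · simp [mul_assoc]
      · rintro ⟨_, ⟨⟨a, p⟩, ⟨ha, hp⟩, rfl⟩, _, rfl, v, hv, rfl⟩
        obtain ⟨u, hu, w, hw, rfl⟩ := mem_PS_cons.1 hv
        rw [mem_cj] at hu
        refine ⟨a * (p.1 * u * p.1⁻¹), H.mul_mem (hEH ha) hu.1, p.1 * w, ?_, ?_⟩
        · rw [hF2]
          simp only [Set.mem_iUnion, exists_prop]
          exact ⟨p, hp, _, rfl, w, hw, rfl⟩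
        · simp [mul_assoc]

lemma PS_le {M : Subgroup G} (l : List (Subgroup G)) (hl : ∀ H ∈ l, H ≤ M) {x : G}
    (hx : x ∈ PS l) : x ∈ M := by
  induction l generalizing x with
  | nil => simp [PS] at hx; simp [hx]
  | cons H l ih =>
    obtain ⟨u, hu, w, hw, rfl⟩ := mem_PS_cons.1 hx
    exact M.mul_mem (hl H (by simp) hu) (ih (fun K hK => hl K (by simp [hK])) hw)

lemma PS_sep_of {Q : Type*} [Group Q] (h : ProductSeparable Q) (l : List (Subgroup Q))
    (hl : ∀ H ∈ l, H.FG) : SeparableSubset (PS l) := by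
  have := h l.length (fun i => l.get i) (fun i => hl _ (List.get_mem _ _))
  have e : (List.ofFn fun i => ((l.get i : Subgroup Q) : Set Q)) =
      l.map (fun H : Subgroup Q => (H : Set Q)) := by
    apply List.ext_getElem <;> simp
  rw [e] at this
  exact this

variable {Q : Type*} [Group Q] (φ : G →* Q)

lemma sep_mul_ker (hQ : ProductSeparable Q) (M : Subgroup G) [M.Normal] [M.FiniteIndex]
    (l : List (Subgroup G)) (hl : ∀ H ∈ l, H.FG) :
    SeparableSubset (PS l * ((M ⊓ φ.ker : Subgroup G) : Set G)) := by
  obtain ⟨F, hF, hF1, hF2⟩ := decomp M l hl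
  have e : PS l * ((M ⊓ φ.ker : Subgroup G) : Set G) =
      ⋃ p ∈ F, {p.1} * ((M : Set G) ∩ φ ⁻¹' (PS (p.2.map (Subgroup.map φ)))) := by
    rw [hF2, Set.iUnion₂_mul]
    refine Set.iUnion₂_congr fun p hp => ?_
    rw [mul_assoc]
    congr 1
    ext x
    rw [← map_PS]
    constructor
    · rintro ⟨u, hu, z, hz, rfl⟩
      refine ⟨M.mul_mem (PS_le _ (fun H hH => (hF1 p hp H hH).2) hu) hz.1, u, hu, ?_⟩
      have : φ z = 1 := hz.2
      simp [this]
    · rintro ⟨hx, u, hu, e⟩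
      refine ⟨u, hu, u⁻¹ * x, ⟨?_, ?_⟩, by simp⟩
      · exact M.mul_mem (M.inv_mem (PS_le _ (fun H hH => (hF1 p hp H hH).2) hu)) hx
      · change φ _ = 1
        simp [e]
  rw [e]
  refine sep_biUnion hF _ fun p hp => sep_left (sep_inter (sep_normal M) (sep_preimage φ ?_)) _
  apply PS_sep_of hQ
  intro H hH
  obtain ⟨K, hK, rfl⟩ := List.mem_map.1 hH
  exact fgmap (hF1 p hp K hK).1 _

/-- the key reduction -/
lemma key (hQ : ProductSeparable Q) (l : List (Subgroup G)) (hl : ∀ H ∈ l, H.FG)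
    (g : G) (U : Set G) (hU : SeparableSubset U) (hgU : g ∉ U)
    (h : ∀ z ∈ φ.ker, g * z ∈ PS l → g * z ∈ U) :
    ∃ N : Subgroup G, N.Normal ∧ N.FiniteIndex ∧ ∀ x ∈ N, g * x ∉ PS l := by
  obtain ⟨M, h1, h2, h3⟩ := hU g hgU
  have hg : g ∉ PS l * ((M ⊓ φ.ker : Subgroup G) : Set G) := by
    rintro ⟨s, hs, z, hz, e⟩
    have e' : s = g * z⁻¹ := by rw [← e]; simp
    refine h3 z⁻¹ (M.inv_mem hz.1) (h _ (inv_mem hz.2) ?_)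
    rwa [← e']
  obtain ⟨N, k1, k2, k3⟩ := sep_mul_ker φ hQ M l hl g hg
  refine ⟨N, k1, k2, fun x hx hs => k3 x hx ?_⟩
  exact ⟨_, hs, 1, one_mem _, by simp⟩

lemma tele : ∀ (n : ℕ) (t : Fin (n + 1) → G) (h : Fin n → G),
    (List.ofFn fun i => (t i.castSucc)⁻¹ * h i * t i.succ).prod =
      (t 0)⁻¹ * (List.ofFn h).prod * t (Fin.last n)
  | 0, t, h => by simp
  | n + 1, t, h => by
    rw [List.ofFn_succ, List.prod_cons, List.ofFn_succ, List.prod_cons]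
    have := tele n (fun i => t i.succ) (fun i => h i.succ)
    simp only [Fin.succ_castSucc] at this
    rw [this]
    simp [mul_assoc]

lemma mem_PS_mul {L : Subgroup G} (hL : L ≤ Subgroup.center G) (l : List (Subgroup G))
    (hne : l ≠ []) (hl : ∀ H ∈ l, L ≤ H) {x e : G} (he : e ∈ L) (hx : x ∈ PS l) :
    x * e ∈ PS l := by
  cases l with
  | nil => simp at hne
  | cons H l =>
    obtain ⟨u, hu, w, hw, rfl⟩ := mem_PS_cons.1 hx
    refine mem_PS_cons.2 ⟨u * e, H.mul_mem hu (hl H (by simp) he), w, hw, ?_⟩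
    have := Subgroup.mem_center_iff.1 (hL he) w
    simp [mul_assoc, this]

/-- One inductive step, when the subgroups contain the relevant central elements. -/
lemma step (hZ : φ.ker ≤ Subgroup.center G) (hQ : ProductSeparable Q)
    (hbot : HasBottleneckedProductReps Q (fun W => W.FG))
    (n : ℕ) (hn : 2 ≤ n) (H : Fin n → Subgroup G) (hH : ∀ i, (H i).FG)
    (ih : ∀ l : List (Subgroup G), l.length + 1 = n → (∀ K ∈ l, K.FG) → SeparableSubset (PS l))
    (ha : ∀ i : Fin n, ∀ hi : (i : ℕ) + 1 < n, ∀ a ∈ H i, ∀ b ∈ H ⟨(i : ℕ) + 1, hi⟩,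
      a * b ∈ φ.ker → ∀ j, a * b ∈ H j)
    (hb : ∀ i, ∀ a ∈ H i, a ∈ φ.ker → ∀ j, a ∈ H j) :
    SeparableSubset (PS (List.ofFn H)) := by
  intro g hg
  have hFG : ∀ K ∈ List.ofFn H, K.FG := by
    intro K hK
    obtain ⟨i, rfl⟩ := (List.mem_ofFn' _ _).1 hK
    exact hH i
  have hlist : ∀ {X : Type _} (f : Fin n → X), List.ofFn f = (List.finRange n).map f :=
    fun f => List.ofFn_eq_map
  have hprod : ∀ h : Fin n → G, (∀ i, h i ∈ H i) → (List.ofFn h).prod ∈ PS (List.ofFn H) := by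
    intro h hh
    rw [List.ofFn_eq_map, List.ofFn_eq_map]
    exact mem_PS_map _ _ _ hh
  have hQS : ∀ (K : Fin n → Subgroup Q), (List.ofFn fun i => ((K i : Set Q))).prod =
      PS (List.ofFn K) := by
    intro K; rw [PS, List.map_ofFn]; rfl
  have hmem : ∀ x ∈ PS (List.ofFn H), ∃ h : Fin n → G, (∀ i, h i ∈ H i) ∧
      (List.ofFn h).prod = x := by
    intro x hx
    have e : PS (List.ofFn H) = (List.ofFn fun i => ((H i : Set G))).prod := by
      rw [PS, List.map_ofFn]; rfl
    rw [e, Set.mem_prod_list_ofFn] at hx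
    obtain ⟨f, hf⟩ := hx
    exact ⟨fun i => f i, fun i => (f i).2, hf⟩
  by_cases hgQ : φ g ∈ (List.ofFn fun i => (((H i).map φ : Subgroup Q) : Set Q)).prod
  swap
  · refine key φ hQ _ hFG g ∅ sep_empty (by simp) ?_
    intro z hz hs
    exfalso
    apply hgQ
    rw [hQS]
    have : (List.ofFn fun i => (H i).map φ) = (List.ofFn H).map (Subgroup.map φ) := by
      rw [List.map_ofFn]; rfl
    rw [this, ← map_PS]
    refine ⟨_, hs, ?_⟩
    have : φ z = 1 := hz
    simp [this]
  obtain ⟨R, hR, ⟨i, hfin⟩, hRe⟩ := hbot n (by omega) (fun i => (H i).map φ)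
    (fun i => fgmap (hH i) φ) (φ g) hgQ
  obtain ⟨L1, L2, hsplit⟩ := List.append_of_mem (List.mem_finRange i)
  have hlen : L1.length + L2.length + 1 = n := by
    have := congrArg List.length hsplit
    simp at this; omega
  have hP : ∀ q ∈ ((fun h : Fin n → Q => h i) '' R), ∃ p ∈ H i, φ p = q := by
    rintro _ ⟨k, hk, rfl⟩
    exact (hR k hk).1 i
  choose! P hPH hPq using hP
  let T : G → List (Subgroup G) := fun p => (L1.map H).map (cj p) ++ L2.map H
  have hTFG : ∀ p, ∀ K ∈ T p, K.FG := by
    intro p K hK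
    simp only [T, List.mem_append, List.mem_map] at hK
    rcases hK with ⟨_, ⟨j, _, rfl⟩, rfl⟩ | ⟨j, _, rfl⟩
    · exact cj_FG (hH j)
    · exact hH j
  refine key φ hQ _ hFG g (⋃ q ∈ ((fun h : Fin n → Q => h i) '' R), {P q} * PS (T (P q)))
    (sep_biUnion hfin _ fun q hq => sep_left (ih _ ?_ (hTFG _)) _) ?_ ?_
  · simp [T]; omega
  · intro hgU
    simp only [Set.mem_iUnion, exists_prop] at hgU
    obtain ⟨q, hq, _, rfl, y, hy, rfl⟩ := hgU
    apply hg
    rw [hlist, hsplit, List.map_append, List.map_cons, PS_append, PS_cons]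
    simp only [T, PS_append] at hy
    obtain ⟨a, ha', b, hb', rfl⟩ := hy
    refine ⟨P q * a * (P q)⁻¹, ?_, P q * b, ⟨P q, hPH q hq, b, hb', rfl⟩, by simp [mul_assoc]⟩
    rw [cj_PS (P q)]
    simpa [mul_assoc] using ha'
  · intro z hz hs
    obtain ⟨h, hh, hhz⟩ := hmem _ hs
    obtain ⟨k, hk, s, hs0, hsl, hsi, hse⟩ := hRe (fun i => φ (h i)) ⟨fun i => ⟨_, hh i, rfl⟩, by
      have := congrArg φ hhz
      rw [map_list_prod, List.map_ofFn] at this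
      have hz' : φ z = 1 := hz
      rw [map_mul, hz', mul_one] at this
      exact this⟩
    have ht : ∀ j : Fin (n + 1), ∃ t, φ t = s j ∧ (∀ i : Fin n, j = i.castSucc → t ∈ H i) ∧
        (∀ i : Fin n, j = i.succ → t ∈ H i) ∧ (j = 0 → t = 1) ∧ (j = Fin.last n → t = 1) := by
      intro j
      by_cases h0 : j = 0
      · exact ⟨1, by rw [h0, hs0]; simp, fun _ _ => one_mem _, fun _ _ => one_mem _, by simp, by simp⟩
      by_cases h1 : j = Fin.last n
      · exact ⟨1, by rw [h1, hsl]; simp, fun _ _ => one_mem _, fun _ _ => one_mem _, by simp, by simp⟩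
      obtain ⟨m, rfl⟩ := Fin.exists_succ_eq.2 h0
      have hm : (m : ℕ) + 1 < n := by
        have h2 : (m.succ : ℕ) ≠ n := fun h => h1 (Fin.ext h)
        simp at h2
        have := m.2
        omega
      obtain ⟨⟨a, ha1, ha2⟩, ⟨b, hb1, hb2⟩⟩ := hsi m hm
      have hab : a⁻¹ * b ∈ φ.ker := by
        change φ _ = 1
        simp [ha2, hb2]
      have hab' := ha m hm a⁻¹ (inv_mem ha1) b hb1 hab
      refine ⟨b, hb2, ?_, ?_, fun h => absurd h h0, fun h => absurd h h1⟩
      · intro i' hi'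
        have : i' = ⟨(m : ℕ) + 1, hm⟩ := by
          apply Fin.ext
          have := congrArg Fin.val hi'
          simpa using this.symm
        rw [this]; exact hb1
      · intro i' hi'
        have : i' = m := (Fin.succ_injective _ hi').symm
        rw [this]
        have := (H m).mul_mem ha1 (hab' m)
        simpa using this
    choose t ht1 ht2 ht3 ht4 ht5 using ht
    let h' : Fin n → G := fun i => (t i.castSucc)⁻¹ * h i * t i.succ
    have hh' : ∀ i, h' i ∈ H i := fun i =>
      (H i).mul_mem ((H i).mul_mem (inv_mem (ht2 _ i rfl)) (hh i)) (ht3 _ i rfl)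
    have hp' : (List.ofFn h').prod = g * z := by
      rw [tele, ht4 0 rfl, ht5 _ rfl, hhz]; simp
    have hq : k i ∈ ((fun h : Fin n → Q => h i) '' R) := ⟨k, hk, rfl⟩
    have hi' : φ (h' i) = k i := by
      simp only [h', map_mul, map_inv, ht1]
      rw [mul_assoc, ← hse i]; simp
    have he : (P (k i))⁻¹ * h' i ∈ φ.ker := by
      change φ _ = 1
      simp [hi', hPq _ hq]
    have heH : (P (k i))⁻¹ * h' i ∈ H i := (H i).mul_mem (inv_mem (hPH _ hq)) (hh' i)
    have heH' := hb i _ heH he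
    simp only [Set.mem_iUnion, exists_prop]
    refine ⟨k i, hq, _, rfl, (P (k i))⁻¹ * (g * z), ?_, by simp⟩
    rw [← hp', List.ofFn_eq_map, hsplit, List.map_append, List.map_cons, List.prod_append,
      List.prod_cons]
    generalize hE : (P (k i))⁻¹ * h' i = E at he heH heH'
    have hEi : h' i = P (k i) * E := by rw [← hE]; simp
    have hA := (cj_PS (P (k i)) (L1.map H)).1 (mem_PS_map L1 H h' hh')
    have hB := mem_PS_map L2 H h' hh'
    have hAB : ((P (k i))⁻¹ * (L1.map h').prod * P (k i)) * (L2.map h').prod ∈ PS (T (P (k i))) := by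
      simp only [T, PS_append]
      exact ⟨_, hA, _, hB, rfl⟩
    have hcen := Subgroup.mem_center_iff.1 (hZ he)
    have := mem_PS_mul (L := Subgroup.zpowers E) (by
        rw [Subgroup.zpowers_le]; exact hZ he) (T (P (k i))) (by
        intro h0
        have := congrArg List.length h0
        simp [T] at this
        simp [this] at hlen
        omega) (by
        intro K hK
        rw [Subgroup.zpowers_le]
        simp only [T, List.mem_append, List.mem_map] at hK
        rcases hK with ⟨_, ⟨j, _, rfl⟩, rfl⟩ | ⟨j, _, rfl⟩
        · rw [mem_cj, hcen]; simpa using heH' j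
        · exact heH' j) (Subgroup.mem_zpowers E) hAB
    rw [hEi]
    have e : (P (k i))⁻¹ * ((L1.map h').prod * (P (k i) * E * (L2.map h').prod)) =
      (P (k i))⁻¹ * (L1.map h').prod * P (k i) * (L2.map h').prod * E := by
      simp only [mul_assoc]
      rw [hcen]
    rw [e]; exact this

lemma PS_sup {L : Subgroup G} (hL : L ≤ Subgroup.center G) (l : List (Subgroup G)) {x : G}
    (hx : x ∈ PS (l.map (· ⊔ L))) : ∃ y ∈ PS l, ∃ e ∈ L, x = y * e := by
  have : L.Normal := normal_of_le_center hL
  induction l generalizing x with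
  | nil => exact ⟨x, hx, 1, one_mem _, by simp⟩
  | cons H l ih =>
    rw [List.map_cons] at hx
    obtain ⟨u, hu, w, hw, rfl⟩ := mem_PS_cons.1 hx
    obtain ⟨y, hy, e, he, rfl⟩ := ih hw
    obtain ⟨h, hh, f, hf, rfl⟩ := Subgroup.mem_sup_of_normal_right.1 hu
    refine ⟨h * y, mem_PS_cons.2 ⟨_, hh, _, hy, rfl⟩, f * e, mul_mem hf he, ?_⟩
    have := Subgroup.mem_center_iff.1 (hL hf) y
    simp only [mul_assoc]
    rw [← mul_assoc f y, ← this, mul_assoc]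

lemma PS_mono_map {ι : Type*} (L : List ι) (H K : ι → Subgroup G) (h : ∀ i, H i ≤ K i) :
    PS (L.map H) ⊆ PS (L.map K) := by
  induction L with
  | nil => exact subset_rfl
  | cons a L ih =>
    simp only [List.map_cons, PS_cons]
    exact Set.mul_subset_mul (h a) ih

/-- central stabilizer of a set -/
def stab (Z : Subgroup G) (S : Set G) : Subgroup G where
  carrier := {z | z ∈ Z ∧ ∀ s, s * z ∈ S ↔ s ∈ S}
  one_mem' := ⟨one_mem _, by simp⟩
  mul_mem' := by
    rintro a b ⟨ha, ha'⟩ ⟨hb, hb'⟩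
    exact ⟨mul_mem ha hb, fun s => by rw [← mul_assoc, hb', ha']⟩
  inv_mem' := by
    rintro a ⟨ha, ha'⟩
    exact ⟨inv_mem ha, fun s => by rw [← ha']; simp⟩

lemma mem_stab {Z : Subgroup G} {S : Set G} {z : G} (hz : z ∈ Z) (h1 : ∀ s ∈ S, s * z ∈ S)
    (h2 : ∀ s ∈ S, s * z⁻¹ ∈ S) : z ∈ stab Z S :=
  ⟨hz, fun s => ⟨fun h => by simpa using h2 _ h, h1 s⟩⟩

lemma fg_of_le_central {Z L : Subgroup G} (hZ : Z ≤ Subgroup.center G) (hfg : Z.FG)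
    (hL : L ≤ Z) : L.FG := by
  have : Group.FG Z := (Group.fg_iff_subgroup_fg Z).2 hfg
  letI : CommGroup Z := { (inferInstance : Group Z) with
    mul_comm := fun a b => Subtype.ext (Subgroup.mem_center_iff.1 (hZ b.2) a) }
  have : Module.Finite ℤ (Additive Z) := by
    rw [Module.Finite.iff_addGroup_fg]
    exact GroupFG.iff_add_fg.1 inferInstance
  have h1 : (L.subgroupOf Z).FG := by
    rw [Subgroup.fg_iff_add_fg]
    have := IsNoetherian.noetherian (AddSubgroup.toIntSubmodule (L.subgroupOf Z).toAddSubgroup)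
    rw [Submodule.fg_iff_addSubgroup_fg] at this
    simpa using this
  have := fgmap h1 Z.subtype
  rwa [Subgroup.subgroupOf_map_subtype, inf_eq_left.2 hL] at this

lemma ins1 (A B : List (Subgroup G)) (H : Subgroup G) {z s : G}
    (hz : z ∈ Subgroup.center G) (hzH : z ∈ H) (hs : s ∈ PS (A ++ H :: B)) :
    s * z ∈ PS (A ++ H :: B) := by
  rw [PS_append, PS_cons] at *
  obtain ⟨a, ha, _, ⟨h, hh, b, hb, rfl⟩, rfl⟩ := hs
  refine ⟨a, ha, _, ⟨h * z, H.mul_mem hh hzH, b, hb, rfl⟩, ?_⟩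
  have := Subgroup.mem_center_iff.1 hz b
  simp [mul_assoc, this]

lemma ins2 (A B : List (Subgroup G)) (H K : Subgroup G) {x y s : G}
    (hz : x * y ∈ Subgroup.center G) (hx : x ∈ H) (hy : y ∈ K) (hs : s ∈ PS (A ++ H :: K :: B)) :
    s * (x * y) ∈ PS (A ++ H :: K :: B) := by
  rw [PS_append, PS_cons, PS_cons] at *
  obtain ⟨a, ha, _, ⟨h, hh, _, ⟨k, hk, b, hb, rfl⟩, rfl⟩, rfl⟩ := hs
  refine ⟨a, ha, _, ⟨h * x, H.mul_mem hh hx, _, ⟨y * k, K.mul_mem hy hk, b, hb, rfl⟩, rfl⟩, ?_⟩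
  have := Subgroup.mem_center_iff.1 hz (k * b)
  calc a * (h * x * (y * k * b)) = a * h * ((x * y) * (k * b)) := by simp only [mul_assoc]
    _ = _ := by rw [← this]; simp only [mul_assoc]

lemma main (hZ : φ.ker ≤ Subgroup.center G) (hZfg : φ.ker.FG) (hQ : ProductSeparable Q)
    (hG : SubgroupSeparable G)
    (hbot : HasBottleneckedProductReps Q (fun W => W.FG)) (n : ℕ) :
    ∀ l : List (Subgroup G), l.length = n → (∀ K ∈ l, K.FG) → SeparableSubset (PS l) := by
  induction n with
  | zero =>
    intro l hl _
    rw [List.length_eq_zero_iff.1 hl, PS_nil]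
    simpa using hG ⊥ Subgroup.FG.bot
  | succ n ih =>
    intro l hl hFG
    by_cases hn : n = 0
    · subst hn
      obtain ⟨H, rfl⟩ := List.length_eq_one_iff.1 hl
      have : PS [H] = (H : Set G) := by simp [PS]
      rw [this]
      exact hG H (hFG H (by simp))
    let L := stab φ.ker (PS l)
    have hLZ : L ≤ φ.ker := fun x hx => hx.1
    have hLc := hLZ.trans hZ
    have hLfg : L.FG := fg_of_le_central hZ hZfg hLZ
    let l' := l.map (· ⊔ L)
    have hl' : l'.length = n + 1 := by simp [l', hl]
    have hS : PS l' = PS l := by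
      apply Set.Subset.antisymm
      · intro x hx
        obtain ⟨y, hy, e, he, rfl⟩ := PS_sup hLc l hx
        exact (he.2 y).2 hy
      · have := PS_mono_map l id (· ⊔ L) (fun i => le_sup_left)
        rwa [List.map_id] at this
    have hl'L : ∀ K ∈ l', L ≤ K := by
      intro K hK
      obtain ⟨K', _, rfl⟩ := List.mem_map.1 hK
      exact le_sup_right
    have hl'FG : ∀ K ∈ l', K.FG := by
      intro K hK
      obtain ⟨K', h, rfl⟩ := List.mem_map.1 hK
      exact (hFG K' h).sup hLfg
    obtain ⟨H, hH⟩ : ∃ H : Fin (n + 1) → Subgroup G, l' = List.ofFn H := by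
      refine ⟨fun i => l'[(i : ℕ)], ?_⟩
      apply List.ext_getElem
      · simp [hl']
      · intro m h1 h2
        rw [List.getElem_ofFn]
    have hHm : ∀ i, H i ∈ l' := fun i => by rw [hH, List.mem_ofFn']; exact ⟨i, rfl⟩
    rw [← hS, hH]
    refine step φ hZ hQ hbot (n + 1) (by omega) H (fun i => hl'FG _ (hHm i))
      (fun l hl => ih l (by omega)) ?_ ?_
    · intro i hi a ha b hb hab j
      apply hl'L _ (hHm j)
      have hsp : l' = l'.take i ++ H i :: H ⟨(i : ℕ) + 1, hi⟩ :: l'.drop (i + 2) := by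
        conv_lhs => rw [← List.take_append_drop i l']
        rw [List.drop_eq_getElem_cons (by omega), List.drop_eq_getElem_cons (by omega)]
        simp only [hH, List.getElem_ofFn]
      have hab' : a⁻¹ * b⁻¹ = (a * b)⁻¹ := by
        have := Subgroup.mem_center_iff.1 (hZ hab) a
        have h2 : a * b = b * a := by
          rw [mul_assoc] at this
          exact (mul_left_cancel this)
        rw [h2]; simp
      refine mem_stab hab ?_ ?_
      · rw [← hS, hsp]
        intro s hs
        exact ins2 _ _ _ _ (hZ hab) ha hb hs
      · rw [← hS, hsp, ← hab']
        intro s hs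
        exact ins2 _ _ _ _ (by rw [hab']; exact inv_mem (hZ hab)) (inv_mem ha) (inv_mem hb) hs
    · intro i a ha haZ j
      apply hl'L _ (hHm j)
      obtain ⟨A, B, hsp⟩ := List.append_of_mem (hHm i)
      refine mem_stab haZ ?_ ?_
      · rw [← hS, hsp]
        intro s hs
        exact ins1 _ _ _ (hZ haZ) ha hs
      · rw [← hS, hsp]
        intro s hs
        exact ins1 _ _ _ (inv_mem (hZ haZ)) (inv_mem ha) hs

end

end CExt

/-- a subgroup separable central extension of a product separable group with
bottlenecked product representatives over finitely generated subgroups is product separable. -/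
theorem central_ext_product_separable
    (G : Type*) [Group G] (Z : Subgroup G) (hZle : Z ≤ Subgroup.center G) (hZfg : Z.FG)
    (hQps : letI : Z.Normal := normal_of_le_center hZle
      ProductSeparable (G ⧸ Z))
    (hGss : SubgroupSeparable G)
    (hbot : letI : Z.Normal := normal_of_le_center hZle
      HasBottleneckedProductReps (G ⧸ Z) (fun W => W.FG)) :
    ProductSeparable G := by
  letI : Z.Normal := normal_of_le_center hZle
  intro n H hH
  have hk : (QuotientGroup.mk' Z).ker = Z := QuotientGroup.ker_mk' Z
  have := CExt.main (QuotientGroup.mk' Z) (by rw [hk]; exact hZle) (by rw [hk]; exact hZfg)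
    hQps hGss hbot n (List.ofFn H) (by simp) (by
      intro K hK
      obtain ⟨i, rfl⟩ := (List.mem_ofFn' _ _).1 hK
      exact hH i)
  rw [CExt.PS, List.map_ofFn] at this
  exact this
end

section
/- Let G be a group, Z a normal subgroup of G, and H a subgroup of G. Suppose that (i) for every finite-index subgroup K of Z, the product set HK = {hk : h ∈ H, k ∈ K} is separable in G, and (ii) H ∩ Z is separable as a subset of the group Z. Then H is separable in G. -/
open scoped Pointwise

/-- if `HK` is separable in `G` for every finite-index subgroup `K ≤ Z`,
and `H ∩ Z` is separable in `Z`, then `H` is separable in `G`. -/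
theorem separable_subgroup_of_extension
    (G : Type*) [Group G] (Z : Subgroup G) [Z.Normal] (H : Subgroup G)
    (h1 : ∀ K : Subgroup G, K ≤ Z → (K.subgroupOf Z).FiniteIndex →
      SeparableSubset ((H : Set G) * (K : Set G)))
    (h2 : SeparableSubset ((H.subgroupOf Z : Subgroup Z) : Set Z)) :
    SeparableSubset (H : Set G) := by
  intro g hg
  have key : ∀ K : Subgroup G, K ≤ Z → (K.subgroupOf Z).FiniteIndex →
      g ∉ ((H : Set G) * (K : Set G)) →
      ∃ N : Subgroup G, N.Normal ∧ N.FiniteIndex ∧ ∀ x ∈ N, g * x ∉ (H : Set G) := by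
    intro K hK hf hgK
    obtain ⟨N, hN, hNf, hd⟩ := h1 K hK hf g hgK
    exact ⟨N, hN, hNf, fun x hx hm => hd x hx ⟨g * x, hm, 1, K.one_mem, mul_one _⟩⟩
  by_cases hgZ : g ∈ ((H : Set G) * (Z : Set G))
  · obtain ⟨h, hh, z, hz, rfl⟩ := hgZ
    have hzH : (⟨z, hz⟩ : Z) ∉ ((H.subgroupOf Z : Subgroup Z) : Set Z) := fun hm =>
      hg (H.mul_mem hh (Subgroup.mem_subgroupOf.mp hm))
    obtain ⟨M, hM, hMf, hd⟩ := h2 _ hzH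
    refine key (M.map Z.subtype) (Subgroup.map_subtype_le M) ?_ ?_
    · have : (M.map Z.subtype).subgroupOf Z = M :=
        Subgroup.comap_map_eq_self_of_injective Z.subtype_injective M
      rw [this]; exact hMf
    · rintro ⟨h', hh', k, ⟨m, hm, rfl⟩, he⟩
      refine hd m⁻¹ (M.inv_mem hm) (Subgroup.mem_subgroupOf.mpr ?_)
      have he' : h' * (m : G) = h * z := he
      have : z * (m : G)⁻¹ = h⁻¹ * h' := by
        rw [mul_inv_eq_iff_eq_mul, mul_assoc, he', inv_mul_cancel_left]
      change z * (m : G)⁻¹ ∈ H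
      rw [this]
      exact H.mul_mem (H.inv_mem hh) hh'
  · refine key Z le_rfl ?_ hgZ
    rw [Subgroup.subgroupOf_self]
    infer_instance
end

section
/- Let 𝔓 be a property of groups that is preserved under taking subgroups and under quotients by surjective homomorphisms. Let G be a group with a normal subgroup Z, and set Q = G/Z. Suppose Q is 𝔓-subgroup separable, Z is finitely generated and strongly 𝔓-subgroup separable, and Q is highly residually finite. Then G is 𝔓-subgroup separable. -/
open scoped Pointwise

universe u

/-- For a property `P` of groups, `G` is `P`-subgroup separable if every finitely
generated subgroup of `G` satisfying `P` is separable. -/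
def PSubgroupSeparable (P : ∀ (α : Type u) [Group α], Prop) (G : Type u) [Group G] : Prop :=
  ∀ H : Subgroup G, H.FG → P ↥H → SeparableSubset (H : Set G)

/-- `G` is strongly `P`-subgroup separable if every subgroup of `G` satisfying `P`
is separable. -/
def StronglyPSubgroupSeparable (P : ∀ (α : Type u) [Group α], Prop) (G : Type u) [Group G] :
    Prop :=
  ∀ H : Subgroup G, P ↥H → SeparableSubset (H : Set G)

/-- `Q` is highly residually finite if every group surjecting onto `Q` with finite
kernel is residually finite. -/
def HighlyResiduallyFinite (Q : Type u) [Group Q] : Prop :=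
  ∀ (G : Type u) [Group G], ∀ f : G →* Q, Function.Surjective f → Finite f.ker →
    ResiduallyFinite G

theorem aux_finite_hom {A B : Type*} [Group A] [Group B] [Finite B] (h : Group.FG A) :
    Finite (A →* B) := by
  obtain ⟨S, hS⟩ := Group.fg_def.mp h
  refine Finite.of_injective (fun (f : A →* B) (s : S) => f s) ?_
  intro f g hfg
  apply MonoidHom.eq_of_eqOn_dense hS
  intro x hx
  exact congrFun hfg ⟨x, hx⟩

theorem aux_char {A : Type*} [Group A] (h : Group.FG A) (N : Subgroup A) [N.Normal]
    [N.FiniteIndex] : ∃ K : Subgroup A, K.Characteristic ∧ K.FiniteIndex ∧ K ≤ N := by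
  have : Finite (A ⧸ N) := Subgroup.finite_quotient_of_finiteIndex
  have := aux_finite_hom (B := A ⧸ N) h
  refine ⟨⨅ f : A →* A ⧸ N, f.ker, ?_, ?_, ?_⟩
  · rw [Subgroup.characteristic_iff_le_comap]
    intro φ x hx
    rw [Subgroup.mem_comap, Subgroup.mem_iInf]
    rw [Subgroup.mem_iInf] at hx
    intro f
    exact hx (f.comp φ.toMonoidHom)
  · exact Subgroup.finiteIndex_iInf (fun f => inferInstance)
  · refine (iInf_le _ (QuotientGroup.mk' N)).trans ?_
    rw [QuotientGroup.ker_mk']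

theorem aux_comap {A B : Type*} [Group A] [Group B] (f : A →* B) (hf : Function.Surjective f)
    (K : Subgroup B) (hK : K.FiniteIndex) : (K.comap f).FiniteIndex := by
  constructor
  rw [Subgroup.index_comap_of_surjective K hf]
  exact hK.index_ne_zero

theorem aux_fgmap {A B : Type*} [Group A] [Group B] (f : A →* B) (K : Subgroup A)
    (hK : K.FG) : (K.map f).FG := by
  classical
  obtain ⟨S, rfl⟩ := hK
  exact ⟨S.image f, by rw [MonoidHom.map_closure, Finset.coe_image]⟩

theorem aux_M {G : Type u} [Group G] (Z N : Subgroup G) [Z.Normal] [N.Normal] (hNZ : N ≤ Z)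
    (hfi : (N.subgroupOf Z).FiniteIndex) (hhrf : HighlyResiduallyFinite (G ⧸ Z)) :
    ∃ M : Subgroup G, M.Normal ∧ M.FiniteIndex ∧ ∀ z ∈ Z, z ∈ M → z ∈ N := by
  let f : G ⧸ N →* G ⧸ Z := QuotientGroup.map N Z (MonoidHom.id G) hNZ
  have hf : Function.Surjective f := by
    intro q
    obtain ⟨x, rfl⟩ := QuotientGroup.mk_surjective q
    exact ⟨(x : G ⧸ N), rfl⟩
  have hker : ∀ x : G, (x : G ⧸ N) ∈ f.ker ↔ x ∈ Z := by
    intro x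
    rw [MonoidHom.mem_ker]
    exact QuotientGroup.eq_one_iff x
  have hfin : Finite f.ker := by
    have : Finite (Z ⧸ N.subgroupOf Z) := Subgroup.finite_quotient_of_finiteIndex
    let φ : Z →* f.ker := ((QuotientGroup.mk' N).comp Z.subtype).codRestrict f.ker
      (fun z => (hker z).mpr z.2)
    refine Finite.of_surjective (QuotientGroup.lift (N.subgroupOf Z) φ ?_) ?_
    · intro z hz
      apply Subtype.ext
      exact (QuotientGroup.eq_one_iff (z : G)).mpr hz
    · rintro ⟨q, hq⟩
      obtain ⟨x, rfl⟩ := QuotientGroup.mk_surjective q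
      exact ⟨((⟨x, (hker x).mp hq⟩ : Z) : Z ⧸ N.subgroupOf Z), rfl⟩
  have hrf := hhrf (G ⧸ N) f hf hfin
  have key : ∀ k : f.ker, ∃ M : Subgroup (G ⧸ N), M.Normal ∧ M.FiniteIndex ∧
      ((k : G ⧸ N) ∈ M → (k : G ⧸ N) = 1) := by
    intro k
    by_cases hk : (k : G ⧸ N) = 1
    · exact ⟨⊤, inferInstance, inferInstance, fun _ => hk⟩
    · obtain ⟨M, h1, h2, h3⟩ := hrf _ hk
      exact ⟨M, h1, h2, fun h => absurd h h3⟩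
  choose M hMn hMf hM using key
  have : (⨅ k, M k).Normal := Subgroup.normal_iInf_normal hMn
  have : (⨅ k, M k).FiniteIndex := Subgroup.finiteIndex_iInf hMf
  refine ⟨(⨅ k, M k).comap (QuotientGroup.mk' N), inferInstance,
    aux_comap _ (QuotientGroup.mk'_surjective N) _ inferInstance, ?_⟩
  intro z hz hzM
  rw [Subgroup.mem_comap, Subgroup.mem_iInf] at hzM
  exact (QuotientGroup.eq_one_iff z).mp (hM ⟨(z : G ⧸ N), (hker z).mpr hz⟩ (hzM _))

theorem aux_sep (P : ∀ (α : Type u) [Group α], Prop)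
    (hP_sub : ∀ (α : Type u) [Group α] (H : Subgroup α), P α → P ↥H)
    (hP_quot : ∀ (α β : Type u) [Group α] [Group β] (f : α →* β),
      Function.Surjective f → P α → P β)
    (G : Type u) [Group G] (Z N : Subgroup G) [Z.Normal] [N.Normal] (hNZ : N ≤ Z)
    (hfi : (N.subgroupOf Z).FiniteIndex)
    (hQsep : PSubgroupSeparable P (G ⧸ Z))
    (hhrf : HighlyResiduallyFinite (G ⧸ Z)) (H : Subgroup G) (hfg : H.FG) (hPH : P ↥H)
    (g : G) (hg : ∀ x ∈ N, g * x ∉ H) :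
    ∃ W : Subgroup G, W.Normal ∧ W.FiniteIndex ∧ ∀ x ∈ W, g * x ∉ (H : Set G) := by
  obtain ⟨M, hMn, hMf, hM⟩ := aux_M Z N hNZ hfi hhrf
  let L : Subgroup H := M.subgroupOf H
  have : L.FiniteIndex := inferInstanceAs (M.subgroupOf H).FiniteIndex
  have : Finite (H ⧸ L) := Subgroup.finite_quotient_of_finiteIndex
  have : Group.FG H := (Group.fg_iff_subgroup_fg H).mpr hfg
  let π : H →* G ⧸ Z := (QuotientGroup.mk' Z).comp H.subtype
  have hLfg : L.FG := (Group.fg_iff_subgroup_fg L).mp (Subgroup.fg_of_index_ne_zero L)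
  have hsep : SeparableSubset ((L.map π : Subgroup (G ⧸ Z)) : Set (G ⧸ Z)) :=
    hQsep _ (aux_fgmap π L hLfg)
      (hP_quot _ _ (π.subgroupMap L) (π.subgroupMap_surjective L) (hP_sub _ L hPH))
  have key : ∀ q : H ⧸ L, ∃ W : Subgroup G, W.Normal ∧ W.FiniteIndex ∧
      ∀ w ∈ W, ∀ l ∈ L, ((q.out : H) : G)⁻¹ * g * w ≠ (l : G) := by
    intro q
    set x : G := ((q.out : H) : G)⁻¹ * g with hx
    by_cases hxM : x ∈ M
    · have hnot : (x : G ⧸ Z) ∉ ((L.map π : Subgroup (G ⧸ Z)) : Set (G ⧸ Z)) := by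
        rintro ⟨l, hl, hlx⟩
        have h1 : x⁻¹ * (l : G) ∈ Z := QuotientGroup.eq.mp hlx.symm
        have h2 : x⁻¹ * (l : G) ∈ M := M.mul_mem (M.inv_mem hxM) hl
        apply hg _ (hM _ h1 h2)
        have : g * (x⁻¹ * (l : G)) = ((q.out : H) : G) * l := by rw [hx]; group
        rw [this]
        exact H.mul_mem (q.out).2 l.2
      obtain ⟨V, hVn, hVf, hV⟩ := hsep _ hnot
      refine ⟨V.comap (QuotientGroup.mk' Z), inferInstance,
        aux_comap _ (QuotientGroup.mk'_surjective Z) _ hVf, ?_⟩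
      intro w hw l hl he
      exact hV _ hw ⟨l, hl, by
        change ((l : G) : G ⧸ Z) = _
        rw [← he]; rfl⟩
    · refine ⟨M, hMn, hMf, ?_⟩
      intro w hw l hl he
      apply hxM
      have : x = (l : G) * w⁻¹ := by rw [← he]; group
      rw [this]
      exact M.mul_mem hl (M.inv_mem hw)
  choose W hWn hWf hW using key
  refine ⟨⨅ q, W q, Subgroup.normal_iInf_normal hWn, Subgroup.finiteIndex_iInf hWf, ?_⟩
  intro w hw hgw
  rw [Subgroup.mem_iInf] at hw
  let h : H := ⟨g * w, hgw⟩
  let q : H ⧸ L := (h : H ⧸ L)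
  have hq : (q.out)⁻¹ * h ∈ L := QuotientGroup.eq.mp (Quotient.out_eq' q)
  refine hW q w (hw q) _ hq ?_
  change _ = ((q.out : H) : G)⁻¹ * (g * w)
  rw [mul_assoc]

/-- an extension of a `P`-subgroup separable, highly residually finite group
by a finitely generated strongly `P`-subgroup separable group is `P`-subgroup separable. -/
theorem PSubgroupSeparable_of_extension_highly_residually_finite
    (P : ∀ (α : Type u) [Group α], Prop)
    (hP_sub : ∀ (α : Type u) [Group α] (H : Subgroup α), P α → P ↥H)
    (hP_quot : ∀ (α β : Type u) [Group α] [Group β] (f : α →* β),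
      Function.Surjective f → P α → P β)
    (G : Type u) [Group G] (Z : Subgroup G) [Z.Normal]
    (hQsep : PSubgroupSeparable P (G ⧸ Z))
    (hZfg : Z.FG) (hZsep : StronglyPSubgroupSeparable P ↥Z)
    (hhrf : HighlyResiduallyFinite (G ⧸ Z)) :
    PSubgroupSeparable P G := by
  intro H hfg hPH g hg
  by_cases hc : ∃ z ∈ Z, g * z ∈ H
  · obtain ⟨z, hz, hgz⟩ := hc
    let K : Subgroup Z := H.subgroupOf Z
    have hPK : P ↥K := by
      let φ : ↥(Z.subgroupOf H) →* ↥K :=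
        { toFun := fun x => ⟨⟨x.1.1, x.2⟩, x.1.2⟩
          map_one' := rfl
          map_mul' := fun _ _ => rfl }
      refine hP_quot _ _ φ ?_ (hP_sub _ (Z.subgroupOf H) hPH)
      rintro ⟨⟨x, hxZ⟩, hxH⟩
      exact ⟨⟨⟨x, hxH⟩, hxZ⟩, rfl⟩
    have hzK : (⟨z, hz⟩ : Z)⁻¹ ∉ (K : Set Z) := by
      intro h
      apply hg
      have h' : z⁻¹ ∈ H := h
      have := H.mul_mem hgz h'
      simpa using this
    obtain ⟨N, hNn, hNf, hN⟩ := hZsep K hPK _ hzK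
    obtain ⟨C, hCc, hCf, hCN⟩ := aux_char ((Group.fg_iff_subgroup_fg Z).mpr hZfg) N
    have hCZ : C.map Z.subtype ≤ Z := Subgroup.map_subtype_le C
    have hCn : (C.map Z.subtype).Normal := ConjAct.normal_of_characteristic_of_normal
    refine aux_sep P hP_sub hP_quot G Z (C.map Z.subtype) hCZ ?_ hQsep hhrf H hfg hPH g ?_
    · have : (C.map Z.subtype).subgroupOf Z = C :=
        Subgroup.comap_map_eq_self_of_injective Z.subtype_injective C
      rw [this]; exact hCf
    · rintro _ ⟨c, hc, rfl⟩ hgc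
      apply hN c (hCN hc)
      change z⁻¹ * (c : G) ∈ H
      have := H.mul_mem (H.inv_mem hgz) hgc
      have e : (g * z)⁻¹ * (g * Z.subtype c) = z⁻¹ * (c : G) := by
        simp
      rwa [e] at this
  · push Not at hc
    refine aux_sep P hP_sub hP_quot G Z Z le_rfl ?_ hQsep hhrf H hfg hPH g hc
    rw [Subgroup.subgroupOf_self]; infer_instance
end

section
/- Let 𝔓 be a property of groups that is preserved under taking subgroups and under quotients by surjective homomorphisms. Let G be a group with a normal subgroup Z and a subgroup Q ≤ G such that Z ∩ Q = {1} and ZQ = G (that is, G is a split extension Z ⋊ Q). Suppose Q is 𝔓-subgroup separable and Z is finitely generated and strongly 𝔓-subgroup separable. Then G is 𝔓-subgroup separable. -/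
open scoped Pointwise

universe u

/-- finitely many homomorphisms from a finitely generated group to a finite group -/
lemma finite_hom_of_fg {A B : Type*} [Group A] [Group B] [Finite B] (hA : Group.FG A) :
    Finite (A →* B) := by
  obtain ⟨S, hS⟩ := Group.fg_def.mp hA
  refine Finite.of_injective (fun (f : A →* B) (s : S) => f s) ?_
  intro f f' h
  refine MonoidHom.eq_of_eqOn_dense hS ?_
  intro s hs
  exact congrFun h ⟨s, hs⟩

/-- a finite index normal subgroup of a f.g. normal subgroup contains a finite index one that is
normal in the whole group -/
lemma exists_invariant {G : Type*} [Group G] (Z : Subgroup G) [Z.Normal] (hZ : Z.FG)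
    (N : Subgroup Z) [N.Normal] [N.FiniteIndex] :
    ∃ K : Subgroup G, K.Normal ∧ K ≤ Z ∧ (K.subgroupOf Z).FiniteIndex ∧ K.subgroupOf Z ≤ N := by
  have hfg : Group.FG Z := (Group.fg_iff_subgroup_fg Z).mpr hZ
  have hfin : Finite (Z →* (Z ⧸ N)) := finite_hom_of_fg hfg
  set C : Subgroup Z := ⨅ f : Z →* (Z ⧸ N), f.ker with hC
  have hsub : (C.map Z.subtype).subgroupOf Z = C :=
    Subgroup.comap_map_eq_self_of_injective Z.subtype_injective C
  refine ⟨C.map Z.subtype, ⟨?_⟩, ?_, ?_, ?_⟩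
  · rintro _ ⟨c, hc, rfl⟩ g
    refine ⟨MulAut.conjNormal g c, ?_, by simp⟩
    have hc' : ∀ f : Z →* (Z ⧸ N), f c = 1 := by
      intro f
      exact (Subgroup.mem_iInf.mp hc) f
    refine Subgroup.mem_iInf.mpr fun f => ?_
    exact hc' (f.comp (MulAut.conjNormal g).toMonoidHom)
  · exact Subgroup.map_subtype_le C
  · rw [hsub]
    exact Subgroup.finiteIndex_iInf fun f => inferInstance
  · rw [hsub]
    refine (iInf_le _ (QuotientGroup.mk' N)).trans ?_
    rw [QuotientGroup.ker_mk']

/-- the retraction onto the complement -/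
lemma exists_retraction {G : Type*} [Group G] (Z Q : Subgroup G) [Z.Normal]
    (hdisj : Z ⊓ Q = ⊥) (hprod : (Z : Set G) * (Q : Set G) = Set.univ) :
    ∃ p : G →* Q, (∀ q : Q, p q = q) ∧ (∀ x, p x = 1 ↔ x ∈ Z) := by
  have hb : Function.Bijective ((QuotientGroup.mk' Z).comp Q.subtype) := by
    constructor
    · rw [injective_iff_map_eq_one]
      intro q hq
      have h1 : (q : G) ∈ Z := (QuotientGroup.eq_one_iff _).mp hq
      have h2 : (q : G) ∈ Z ⊓ Q := ⟨h1, q.2⟩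
      rw [hdisj, Subgroup.mem_bot] at h2
      exact Subtype.ext h2
    · intro y
      obtain ⟨x, rfl⟩ := QuotientGroup.mk'_surjective Z y
      have hx : x ∈ (Z : Set G) * (Q : Set G) := by rw [hprod]; trivial
      obtain ⟨z, hz, q, hq, rfl⟩ := hx
      refine ⟨⟨q, hq⟩, ?_⟩
      have hz1 : QuotientGroup.mk' Z z = 1 := (QuotientGroup.eq_one_iff _).mpr hz
      simp only [map_mul, hz1, one_mul]
      rfl
  let e := MulEquiv.ofBijective _ hb
  refine ⟨e.symm.toMonoidHom.comp (QuotientGroup.mk' Z), fun q => e.symm_apply_apply q, ?_⟩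
  intro x
  rw [← QuotientGroup.eq_one_iff]
  exact EmbeddingLike.map_eq_one_iff (f := e.symm)

/-- a split extension `G = Z ⋊ Q` of a `P`-subgroup separable group `Q` by a
finitely generated strongly `P`-subgroup separable group `Z` is `P`-subgroup separable. -/
theorem PSubgroupSeparable_of_split_extension
    (P : ∀ (α : Type u) [Group α], Prop)
    (hP_sub : ∀ (α : Type u) [Group α] (H : Subgroup α), P α → P ↥H)
    (hP_quot : ∀ (α β : Type u) [Group α] [Group β] (f : α →* β),
      Function.Surjective f → P α → P β)
    (G : Type u) [Group G] (Z Q : Subgroup G) [Z.Normal]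
    (hdisj : Z ⊓ Q = ⊥) (hprod : (Z : Set G) * (Q : Set G) = Set.univ)
    (hQsep : PSubgroupSeparable P ↥Q)
    (hZfg : Z.FG) (hZsep : StronglyPSubgroupSeparable P ↥Z) :
    PSubgroupSeparable P G := by
  intro H hHfg hPH g hg
  obtain ⟨p, hpQ, hpZ⟩ := exists_retraction Z Q hdisj hprod
  have hpsurj : Function.Surjective p := fun q => ⟨q, hpQ q⟩
  -- step 1
  have h1 : ∃ K : Subgroup G, K.Normal ∧ K ≤ Z ∧ (K.subgroupOf Z).FiniteIndex ∧
      ∀ h ∈ H, h⁻¹ * g ∉ K := by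
    by_cases hc : ∃ h ∈ H, p h = p g
    · obtain ⟨h0, hh0, hp0⟩ := hc
      have hz : h0⁻¹ * g ∈ Z := by rw [← hpZ]; simp [hp0]
      have hPZ : P (H.subgroupOf Z) := by
        let f : Z.subgroupOf H →* H.subgroupOf Z :=
          { toFun := fun x => ⟨⟨x.1.1, x.2⟩, x.1.2⟩
            map_one' := rfl
            map_mul' := fun _ _ => rfl }
        exact hP_quot _ _ f (fun y => ⟨⟨⟨y.1.1, y.2⟩, y.1.2⟩, rfl⟩) (hP_sub _ _ hPH)
      obtain ⟨N, hN, hNf, hNd⟩ := hZsep _ hPZ ⟨_, hz⟩ (by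
        intro hmem
        have hmem' : h0⁻¹ * g ∈ H := hmem
        exact hg ((H.mul_mem_cancel_left (H.inv_mem hh0)).mp hmem'))
      obtain ⟨K, hK, hKZ, hKf, hKN⟩ := exists_invariant Z hZfg N
      refine ⟨K, hK, hKZ, hKf, fun h hh hk => ?_⟩
      -- h0⁻¹ g (h⁻¹ g)⁻¹ = h0⁻¹ h
      refine hNd ⟨(h⁻¹ * g)⁻¹, hKZ (K.inv_mem hk)⟩ (hKN ?_) ?_
      · exact K.inv_mem hk
      · change h0⁻¹ * g * (h⁻¹ * g)⁻¹ ∈ H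
        have : h0⁻¹ * g * (h⁻¹ * g)⁻¹ = h0⁻¹ * h := by group
        rw [this]
        exact H.mul_mem (H.inv_mem hh0) hh
    · refine ⟨Z, inferInstance, le_rfl, ?_, fun h hh hk => hc ⟨h, hh, ?_⟩⟩
      · rw [Subgroup.subgroupOf_self]; infer_instance
      · rw [← hpZ, map_mul, map_inv, inv_mul_eq_one] at hk
        exact hk
  obtain ⟨K, hK, hKZ, hKf, hgK⟩ := h1
  set M : Subgroup G := K ⊔ Q with hM
  have hMZ : ∀ m ∈ M, m ∈ Z → m ∈ K := by
    intro m hm hmZ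
    obtain ⟨k, hk, q, hq, rfl⟩ := Subgroup.mem_sup_of_normal_left.mp hm
    have hq' : q ∈ Z ⊓ Q := ⟨(Z.mul_mem_cancel_left (hKZ hk)).mp hmZ, hq⟩
    rw [hdisj, Subgroup.mem_bot] at hq'
    simpa [hq'] using hk
  have hMf : M.FiniteIndex := by
    have hs : Function.Surjective (Quotient.map' (s₁ := QuotientGroup.leftRel (K.subgroupOf Z))
        (s₂ := QuotientGroup.leftRel M) (fun z : Z => (z : G)) (by
          intro a b hab
          rw [QuotientGroup.leftRel_apply] at hab ⊢
          exact (le_sup_left : K ≤ M) hab)) := by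
      intro y
      induction y using Quotient.inductionOn' with
      | h x =>
      have hx : x ∈ (Z : Set G) * (Q : Set G) := by rw [hprod]; trivial
      obtain ⟨z, hz, q, hq, rfl⟩ := hx
      refine ⟨Quotient.mk'' ⟨z, hz⟩, ?_⟩
      rw [Quotient.map'_mk'']
      refine Quotient.sound' ?_
      rw [QuotientGroup.leftRel_apply]
      simpa using (le_sup_right : Q ≤ M) hq
    have hf1 : Finite (Z ⧸ K.subgroupOf Z) := inferInstance
    have hf2 : Finite (G ⧸ M) := @Finite.of_surjective _ _ hf1 _ hs
    exact Subgroup.finiteIndex_of_finite_quotient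
  have hHG : Group.FG H := (Group.fg_iff_subgroup_fg H).mpr hHfg
  let φ : M.subgroupOf H →* Q := (p.comp H.subtype).comp (M.subgroupOf H).subtype
  have hLfg : φ.range.FG := (Group.fg_iff_subgroup_fg _).mp (Group.fg_range φ)
  have hLP : P φ.range :=
    hP_quot _ _ φ.rangeRestrict φ.rangeRestrict_surjective (hP_sub _ _ hPH)
  have hLsep := hQsep _ hLfg hLP
  have hstep : ∀ x : G, (∀ h ∈ H, h ∈ M → h⁻¹ * x ∉ K) →
      ∃ U : Subgroup G, U.FiniteIndex ∧ ∀ u ∈ U, x * u ∈ H → x * u ∉ M := by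
    intro x hx
    by_cases hxM : x ∈ M
    · obtain ⟨N, hN, hNf, hNd⟩ := hLsep (p x) (by
        rintro ⟨⟨⟨h, hh⟩, hhM⟩, he⟩
        have hhM' : h ∈ M := hhM
        have he' : p h = p x := he
        refine hx h hh hhM' (hMZ _ (M.mul_mem (M.inv_mem hhM') hxM) ?_)
        rw [← hpZ]; simp [he'])
      refine ⟨N.comap p, ⟨?_⟩, fun u hu huH huM => ?_⟩
      · rw [Subgroup.index_comap_of_surjective _ hpsurj]
        exact hNf.index_ne_zero
      · refine hNd (p u) hu ⟨⟨⟨x * u, huH⟩, huM⟩, ?_⟩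
        exact map_mul p x u
    · exact ⟨M, hMf, fun u hu _ hm => hxM ((M.mul_mem_cancel_right hu).mp hm)⟩
  have hq : ∀ t : H ⧸ M.subgroupOf H, ∃ U : Subgroup G, U.FiniteIndex ∧
      ∀ u ∈ U, (t.out : G)⁻¹ * g * u ∈ H → (t.out : G)⁻¹ * g * u ∉ M := by
    intro t
    refine hstep _ fun h hh _ hk => hgK (t.out * h) (H.mul_mem t.out.2 hh) ?_
    simpa [mul_assoc] using hk
  choose U hUf hU using hq
  have hI : (⨅ t, U t).FiniteIndex := Subgroup.finiteIndex_iInf hUf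
  refine ⟨(⨅ t, U t).normalCore, inferInstance, inferInstance, fun n hn hgn => ?_⟩
  have hgn' : g * n ∈ H := hgn
  have hn' := Subgroup.mem_iInf.mp (Subgroup.normalCore_le _ hn)
  let t : H ⧸ M.subgroupOf H := QuotientGroup.mk ⟨g * n, hgn'⟩
  refine hU t n (hn' t) ?_ ?_
  · rw [mul_assoc]; exact H.mul_mem (H.inv_mem t.out.2) hgn'
  · have : (QuotientGroup.mk t.out : H ⧸ M.subgroupOf H) = QuotientGroup.mk ⟨g * n, hgn'⟩ :=
      QuotientGroup.out_eq' t
    rw [QuotientGroup.eq] at this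
    rw [mul_assoc]
    exact this
end

section
/- Let G be a group, let n ∈ ℕ, let H₁,…,Hₙ be finitely generated subgroups of G, and let K be a normal subgroup of G. If the quotient group G/K is n-coset separable, then the product set H₁⋯HₙK = {h₁⋯hₙk : hᵢ ∈ Hᵢ, k ∈ K} is separable in G. -/
open scoped Pointwise

/-- if `K ⊴ G` and `G/K` is `n`-coset separable, then `H₁ ⋯ Hₙ K` is
separable in `G` for all finitely generated `H₁, …, Hₙ ≤ G`. -/
theorem prod_with_normal_subgroup_separable
    (G : Type*) [Group G] (n : ℕ) (H : Fin n → Subgroup G) (hH : ∀ i, (H i).FG)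
    (K : Subgroup G) [K.Normal] (hQ : NCosetSeparable (G ⧸ K) n) :
    SeparableSubset ((List.ofFn fun i => ((H i : Set G))).prod * (K : Set G)) := by
  intro g hg
  have himg : (QuotientGroup.mk' K) '' ((List.ofFn fun i => ((H i : Set G))).prod)
      = (List.ofFn fun i => (((H i).map (QuotientGroup.mk' K) : Subgroup (G ⧸ K)) :
          Set (G ⧸ K))).prod := by
    rw [Set.image_list_prod, List.map_ofFn]
    rfl
  have key : ∀ x : G, QuotientGroup.mk' K x ∈
      (List.ofFn fun i => (((H i).map (QuotientGroup.mk' K) : Subgroup (G ⧸ K)) :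
          Set (G ⧸ K))).prod ↔ x ∈ (List.ofFn fun i => ((H i : Set G))).prod * (K : Set G) := by
    intro x
    rw [← himg]
    constructor
    · rintro ⟨y, hy, hxy⟩
      exact Set.mem_mul.2 ⟨y, hy, y⁻¹ * x, QuotientGroup.eq.1 hxy, by group⟩
    · intro hx
      obtain ⟨y, hy, k, hk, rfl⟩ := Set.mem_mul.1 hx
      refine ⟨y, hy, QuotientGroup.eq.2 ?_⟩
      simpa using hk
  obtain ⟨N, hN, hNf, hNx⟩ := hQ (fun i => (H i).map (QuotientGroup.mk' K))
    (fun i => by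
      classical
      obtain ⟨S, hS⟩ := hH i
      refine ⟨S.image (QuotientGroup.mk' K), ?_⟩
      rw [Finset.coe_image, ← MonoidHom.map_closure, hS]) (QuotientGroup.mk' K g) (fun h => hg ((key g).1 h))
  refine ⟨N.comap (QuotientGroup.mk' K), hN.comap _, ⟨by
    rw [N.index_comap_of_surjective (QuotientGroup.mk'_surjective K)]; exact hNf.index_ne_zero⟩, fun x hx h => ?_⟩
  exact hNx _ hx (by rw [← map_mul]; exact (key _).2 h)
end

section
/- Let G be a group with a normal subgroup Z such that both G and the quotient Q = G/Z are subgroup separable and Z is finitely generated. Let H be a finitely generated subgroup of G and let K be an arbitrary subgroup of Z. If the product set (H ∩ Z)K is separable as a subset of the group Z, then the product set HK = {hk : h ∈ H, k ∈ K} is separable in G. -/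
open scoped Pointwise

lemma fg_map_aux {A B : Type*} [Group A] [Group B] (f : A →* B) {P : Subgroup A} (h : P.FG) :
    (P.map f).FG := by
  rw [Subgroup.fg_iff_submonoid_fg] at h ⊢
  exact h.map f

lemma finite_hom_aux {A B : Type*} [Group A] [Group B] [hA : Group.FG A] [Finite B] :
    Finite (A →* B) := by
  obtain ⟨S, hS⟩ := hA.1
  refine Finite.of_injective (fun (f : A →* B) (s : S) => f s) ?_
  intro f g h
  refine MonoidHom.eq_of_eqOn_dense hS ?_
  intro x hx
  exact congrFun h ⟨x, hx⟩

lemma exists_char_aux {A : Type*} [Group A] [hA : Group.FG A] (N : Subgroup A) [N.Normal]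
    [N.FiniteIndex] : ∃ M : Subgroup A, M.Characteristic ∧ M.FiniteIndex ∧ M ≤ N := by
  have : Finite (A →* A ⧸ N) := finite_hom_aux
  refine ⟨⨅ f : A →* A ⧸ N, f.ker, ?_, ?_, ?_⟩
  · rw [Subgroup.characteristic_iff_le_comap]
    intro φ x hx
    rw [Subgroup.mem_comap, Subgroup.mem_iInf]
    intro f
    rw [Subgroup.mem_iInf] at hx
    exact hx (f.comp φ.toMonoidHom)
  · exact Subgroup.finiteIndex_iInf fun f => inferInstance
  · refine (iInf_le _ (QuotientGroup.mk' N)).trans ?_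
    rw [QuotientGroup.ker_mk']

/-- with `G`, `G/Z` subgroup separable and `Z ⊴ G` finitely generated,
if `(H ∩ Z)K` is separable in `Z` for a finitely generated `H ≤ G` and `K ≤ Z`, then
`HK` is separable in `G`. -/
theorem double_coset_with_subgroup_of_kernel_separable
    (G : Type*) [Group G] (Z : Subgroup G) [Z.Normal]
    (hG : SubgroupSeparable G) (hQ : SubgroupSeparable (G ⧸ Z)) (hZfg : Z.FG)
    (H : Subgroup G) (hH : H.FG) (K : Subgroup G) (hKZ : K ≤ Z)
    (hsep : SeparableSubset
      (((H.subgroupOf Z : Subgroup Z) : Set Z) * ((K.subgroupOf Z : Subgroup Z) : Set Z))) :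
    SeparableSubset ((H : Set G) * (K : Set G)) := by
  have := (Group.fg_iff_subgroup_fg Z).mpr hZfg
  intro g hg
  by_cases hgZ : (QuotientGroup.mk' Z g) ∈ H.map (QuotientGroup.mk' Z)
  swap
  · obtain ⟨N, hN, hNf, hNs⟩ := hQ (H.map (QuotientGroup.mk' Z)) (fg_map_aux _ hH) _ hgZ
    refine ⟨N.comap (QuotientGroup.mk' Z), inferInstance, ⟨by
      rw [Subgroup.index_comap_of_surjective _ (QuotientGroup.mk'_surjective Z)]
      exact hNf.index_ne_zero⟩, ?_⟩
    intro x hx hmem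
    obtain ⟨h, hh, k, hk, hhk⟩ := Set.mem_mul.mp hmem
    refine hNs _ hx ?_
    rw [← map_mul, ← hhk, map_mul]
    have : QuotientGroup.mk' Z k = 1 := (QuotientGroup.eq_one_iff k).mpr (hKZ hk)
    rw [this, mul_one]
    exact Subgroup.mem_map_of_mem _ hh
  obtain ⟨h0, hh0, hh0g⟩ := hgZ
  have hz : h0⁻¹ * g ∈ Z := QuotientGroup.eq.mp hh0g
  obtain ⟨z, hzdef⟩ : ∃ z : Z, (z : G) = h0⁻¹ * g := ⟨⟨_, hz⟩, rfl⟩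
  have hgz : g = h0 * z := by rw [hzdef]; group
  obtain ⟨N, hN, hNf, hNs⟩ := hsep z (by
    intro hmem
    obtain ⟨a, ha, b, hb, hab⟩ := Set.mem_mul.mp hmem
    apply hg
    refine Set.mem_mul.mpr ⟨h0 * a, H.mul_mem hh0 ha, b, hb, ?_⟩
    rw [hgz, ← hab, Subgroup.coe_mul, mul_assoc])
  obtain ⟨M, hMc, hMf, hMN⟩ := exists_char_aux N
  have hMfg : (M.map Z.subtype).FG :=
    fg_map_aux _ ((Group.fg_iff_subgroup_fg M).mp inferInstance)
  have hHM := hG (H ⊔ M.map Z.subtype) (hH.sup hMfg)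
  have hex : ∀ q : Z ⧸ M, ∃ L : Subgroup G, L.Normal ∧ L.FiniteIndex ∧
      (((q.out : Z) : G) ∉ H ⊔ M.map Z.subtype →
        ∀ x ∈ L, ((q.out : Z) : G) * x ∉ H ⊔ M.map Z.subtype) := by
    intro q
    by_cases hq : ((q.out : Z) : G) ∈ H ⊔ M.map Z.subtype
    · exact ⟨⊤, inferInstance, inferInstance, fun h => absurd hq h⟩
    · obtain ⟨L, h1, h2, h3⟩ := hHM _ hq
      exact ⟨L, h1, h2, fun _ => h3⟩
  choose L hLn hLf hLs using hex
  have key : ∀ w : Z, ∀ x ∈ ⨅ q, L q, (w : G) * x ∈ H → (w : G) ∈ H ⊔ M.map Z.subtype := by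
    intro w x hx hwx
    obtain ⟨m, hm⟩ := QuotientGroup.mk_out_eq_mul M w
    have hmM : ((m : Z) : G) ∈ H ⊔ M.map Z.subtype :=
      Subgroup.mem_sup_right (Subgroup.mem_map_of_mem Z.subtype m.2)
    by_contra hw
    have hout : (((w : Z ⧸ M).out : Z) : G) = w * (m : Z) := by rw [hm]; rfl
    have hno : (((w : Z ⧸ M).out : Z) : G) ∉ H ⊔ M.map Z.subtype := by
      rw [hout, Subgroup.mul_mem_cancel_right _ hmM]; exact hw
    have hxq : x ∈ L (w : Z ⧸ M) := (Subgroup.mem_iInf.mp hx) _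
    have hn := hLn (w : Z ⧸ M)
    have := hn.conj_mem x hxq ((m : Z) : G)⁻¹
    apply hLs _ hno _ this
    rw [hout]
    have e : (w : G) * (m : Z) * (((m : Z) : G)⁻¹ * x * (((m : Z) : G)⁻¹)⁻¹) = w * x * (m : Z) := by
      group
    rw [e]
    exact mul_mem (Subgroup.mem_sup_left hwx) hmM
  have hLN : (⨅ q, L q).Normal := Subgroup.normal_iInf_normal hLn
  refine ⟨⨅ q, L q, hLN, Subgroup.finiteIndex_iInf hLf, ?_⟩
  intro l hl hmem
  obtain ⟨h, hh, k, hk, hhk⟩ := Set.mem_mul.mp hmem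
  have hkey := key (z * ⟨k, hKZ hk⟩⁻¹) (k * l * k⁻¹) (hLN.conj_mem l hl k) (by
    have e : ((z * (⟨k, hKZ hk⟩ : Z)⁻¹ : Z) : G) * (k * l * k⁻¹) = h0⁻¹ * h := by
      have : h = g * l * k⁻¹ := by rw [← hhk]; group
      rw [this, hgz]
      push_cast
      group
    rw [e]
    exact H.mul_mem (H.inv_mem hh0) hh)
  obtain ⟨a, ha, b, hb, hab⟩ := Subgroup.mem_sup_of_normal_right.mp hkey
  obtain ⟨m, hm, rfl⟩ := hb
  have haZ : a ∈ Z := by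
    have : a = ((z * (⟨k, hKZ hk⟩ : Z)⁻¹ : Z) : G) * ((m : Z) : G)⁻¹ := by
      rw [← hab]; simp
    rw [this]
    exact Z.mul_mem (SetLike.coe_mem _) (Z.inv_mem m.2)
  have hMn : M.Normal := inferInstance
  have hmk := hMn.conj_mem m hm (⟨k, hKZ hk⟩ : Z)⁻¹
  apply hNs _ (hMN (M.inv_mem hmk))
  refine Set.mem_mul.mpr ⟨⟨a, haZ⟩, ha, ⟨k, hKZ hk⟩, hk, ?_⟩
  have hab' : (⟨a, haZ⟩ : Z) * m = z * (⟨k, hKZ hk⟩ : Z)⁻¹ := Subtype.ext hab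
  have e : z = (⟨a, haZ⟩ : Z) * m * ⟨k, hKZ hk⟩ := by rw [hab']; group
  rw [e]
  group
end

section
/- Let G be a group with a normal subgroup Z such that both G and the quotient Q = G/Z are subgroup separable. Suppose that every subgroup of Z is finitely generated and that Z is double coset separable. Let K be a subgroup of Z that is normal in G. Then the quotient group G/K is subgroup separable. -/
open scoped Pointwise

/-- if `G` and `G/Z` are subgroup separable, `Z` is slender and double coset
separable, and `K ≤ Z` is normal in `G`, then `G/K` is subgroup separable. -/
theorem quotient_subgroup_separable_of_slender_kernel
    (G : Type*) [Group G] (Z : Subgroup G) [Z.Normal]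
    (hG : SubgroupSeparable G) (hQ : SubgroupSeparable (G ⧸ Z))
    (hslender : ∀ W : Subgroup ↥Z, W.FG) (hZdcs : DoubleCosetSeparable ↥Z)
    (K : Subgroup G) (hKZ : K ≤ Z) [K.Normal] :
    SubgroupSeparable (G ⧸ K) := by
  intro H hH g hg
  have hKfg : K.FG := by
    classical
    obtain ⟨S, hS⟩ := hslender (K.subgroupOf Z)
    refine ⟨S.image Z.subtype, ?_⟩
    rw [Finset.coe_image, ← MonoidHom.map_closure, hS, Subgroup.subgroupOf_map_subtype,
      inf_eq_left.mpr hKZ]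
  have hLfg : (H.comap (QuotientGroup.mk' K)).FG := by
    classical
    obtain ⟨S, hS⟩ := hH
    have hL : Subgroup.map (QuotientGroup.mk' K)
        (Subgroup.closure ((S.image Quotient.out : Finset G) : Set G)) = H := by
      rw [MonoidHom.map_closure, ← hS]
      congr 1
      ext x
      simp
    have h2 : H.comap (QuotientGroup.mk' K)
        = Subgroup.closure ((S.image Quotient.out : Finset G) : Set G) ⊔ K := by
      rw [← hL, Subgroup.comap_map_eq, QuotientGroup.ker_mk']
    rw [h2]
    exact Subgroup.FG.sup ⟨_, rfl⟩ hKfg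
  obtain ⟨a, rfl⟩ := QuotientGroup.mk'_surjective K g
  obtain ⟨N, hN, hfi, hd⟩ := hG _ hLfg a hg
  refine ⟨N.map (QuotientGroup.mk' K), hN.map _ (QuotientGroup.mk'_surjective K), ?_, ?_⟩
  · exact ⟨fun h0 => hfi.index_ne_zero (Nat.eq_zero_of_zero_dvd (h0 ▸
      N.index_map_dvd (QuotientGroup.mk'_surjective K)) )⟩
  · rintro _ ⟨n, hn, rfl⟩ hx
    apply hd n hn
    simpa using hx
end

section
/- Let G be a group and let Z be a finitely generated subgroup of the center of G such that the quotient G/Z is subgroup separable. If G is subgroup separable, then for every subgroup K of Z the quotient group G/K is subgroup separable. (Note that any subgroup of Z is automatically normal in G, since Z is central.) -/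
open scoped Pointwise

lemma fg_of_le_fg_comm {A : Type*} [CommGroup A] (hA : Group.FG A) (K : Subgroup A) : K.FG := by
  rw [Subgroup.fg_iff_add_fg]
  haveI : AddGroup.FG (Additive A) := AddGroup.fg_of_group_fg
  haveI : Module.Finite ℤ (Additive A) := Module.Finite.iff_addGroup_fg.mpr inferInstance
  haveI : IsNoetherian ℤ (Additive A) := inferInstance
  have := IsNoetherian.noetherian (AddSubgroup.toIntSubmodule K.toAddSubgroup)
  rw [Submodule.fg_iff_addSubgroup_fg] at this
  simpa using this

lemma fg_of_le_central {G : Type*} [Group G] {Z K : Subgroup G}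
    (hZ : Z ≤ Subgroup.center G) (hfg : Z.FG) (hK : K ≤ Z) : K.FG := by
  letI : CommGroup Z :=
    { (inferInstance : Group Z) with
      mul_comm := fun a b => Subtype.ext (Subgroup.mem_center_iff.mp (hZ b.2) a) }
  have h := fg_of_le_fg_comm ((Group.fg_iff_subgroup_fg Z).mpr hfg) (K.subgroupOf Z)
  obtain ⟨S, hS⟩ := h
  classical
  refine ⟨S.image Z.subtype, ?_⟩
  rw [Finset.coe_image, ← MonoidHom.map_closure]
  erw [hS]
  exact Subgroup.map_subgroupOf_eq_of_le hK

/-- if `G` is subgroup separable with finitely generated central `Z ≤ Z(G)`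
and `G/Z` subgroup separable, then `G/K` is subgroup separable for every `K ≤ Z`. -/
theorem central_quotient_subgroup_separable
    (G : Type*) [Group G] (Z : Subgroup G) (hZle : Z ≤ Subgroup.center G) (hZfg : Z.FG)
    (hQ : letI : Z.Normal := normal_of_le_center hZle
      SubgroupSeparable (G ⧸ Z))
    (hG : SubgroupSeparable G) :
    ∀ K : Subgroup G, ∀ hK : K ≤ Z,
      letI : K.Normal := normal_of_le_center (hK.trans hZle)
      SubgroupSeparable (G ⧸ K) := by
  intro K hK
  letI : K.Normal := normal_of_le_center (hK.trans hZle)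
  change SubgroupSeparable (G ⧸ K)
  intro H hH g hg
  have hKfg : K.FG := fg_of_le_central hZle hZfg hK
  have hpre : (H.comap (QuotientGroup.mk' K)).FG := by
    classical
    obtain ⟨S, hS⟩ := hH
    let T : Finset G := S.image Quotient.out
    have hT : (Subgroup.closure (T : Set G)).map (QuotientGroup.mk' K) = H := by
      rw [MonoidHom.map_closure, ← hS]
      congr 1
      ext x
      simp [T]
    have : H.comap (QuotientGroup.mk' K) = Subgroup.closure (T : Set G) ⊔ K := by
      rw [← hT, Subgroup.comap_map_eq, QuotientGroup.ker_mk']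
    rw [this]
    exact Subgroup.FG.sup ⟨T, rfl⟩ hKfg
  obtain ⟨g, rfl⟩ := QuotientGroup.mk'_surjective K g
  obtain ⟨N, hN, hNf, hx⟩ := hG _ hpre g hg
  refine ⟨N.map (QuotientGroup.mk' K), hN.map _ (QuotientGroup.mk'_surjective K), ?_, ?_⟩
  · refine ⟨fun h0 => hNf.index_ne_zero ?_⟩
    have := Subgroup.index_map_dvd N (QuotientGroup.mk'_surjective K)
    rw [h0] at this
    exact Nat.eq_zero_of_zero_dvd this
  · rintro _ ⟨x, hxN, rfl⟩ hmem
    exact hx x hxN (by simpa using hmem)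
end

section
/- Let Q be a double coset separable group. Then the direct product Q × ℤ of Q with the infinite cyclic group is double coset separable. -/
open scoped Pointwise

lemma fg_map_aux_s14 {G G' : Type*} [Group G] [Group G'] (f : G →* G') {H : Subgroup G}
    (hH : H.FG) : (H.map f).FG := by
  classical
  obtain ⟨S, rfl⟩ := hH
  exact ⟨S.image f, by rw [Finset.coe_image, MonoidHom.map_closure]⟩

lemma fg_inf_ker_aux {G A : Type*} [Group G] [Group A] [Finite A] (φ : G →* A)
    (H : Subgroup G) (hH : H.FG) : (H ⊓ φ.ker).FG := by
  have : Group.FG H := (Group.fg_iff_subgroup_fg H).2 hH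
  have : (φ.comp H.subtype).ker.FiniteIndex := inferInstance
  have h1 : Group.FG (φ.comp H.subtype).ker := inferInstance
  have h2 : (φ.comp H.subtype).ker.FG := (Group.fg_iff_subgroup_fg _).1 h1
  have h3 := fg_map_aux_s14 H.subtype h2
  convert h3 using 1
  ext x
  simp [Subgroup.mem_map, MonoidHom.mem_ker, and_comm]

lemma sep_mod_aux {Q A : Type*} [Group Q] (hQ : DoubleCosetSeparable Q)
    [CommGroup A] [Finite A] (ψ : Multiplicative ℤ →* A)
    (H K : Subgroup (Q × Multiplicative ℤ)) (hH : H.FG) (hK : K.FG)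
    (g : Q × Multiplicative ℤ)
    (hg : ∀ h ∈ H, ∀ k ∈ K, h.1 * k.1 = g.1 → ψ h.2 * ψ k.2 ≠ ψ g.2) :
    ∃ N : Subgroup (Q × Multiplicative ℤ), N.Normal ∧ N.FiniteIndex ∧
      ∀ x ∈ N, g * x ∉ (H : Set (Q × Multiplicative ℤ)) * (K : Set (Q × Multiplicative ℤ)) := by
  classical
  set φ : Q × Multiplicative ℤ →* A := ψ.comp (MonoidHom.snd Q (Multiplicative ℤ)) with hφ
  have key : ∀ r : A, ∃ N : Subgroup Q, N.Normal ∧ N.FiniteIndex ∧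
      ∀ x ∈ N, ∀ h ∈ H, ∀ k ∈ K, h.1 * k.1 = g.1 * x → ψ h.2 = r → ψ h.2 * ψ k.2 ≠ ψ g.2 := by
    intro r
    by_cases hr : ∃ h ∈ H, ∃ k ∈ K, ψ h.2 = r ∧ ψ h.2 * ψ k.2 = ψ g.2
    · obtain ⟨h0, hh0, k0, hk0, hr0, he0⟩ := hr
      have sep := hQ ((H ⊓ φ.ker).map (MonoidHom.fst Q (Multiplicative ℤ)))
        ((K ⊓ φ.ker).map (MonoidHom.fst Q (Multiplicative ℤ)))
        (fg_map_aux_s14 _ (fg_inf_ker_aux φ H hH)) (fg_map_aux_s14 _ (fg_inf_ker_aux φ K hK))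
        (h0.1⁻¹ * g.1 * k0.1⁻¹) (by
          rintro ⟨p, ⟨h, ⟨hh, hφh⟩, rfl⟩, q, ⟨k, ⟨hk, hφk⟩, rfl⟩, he⟩
          have hφh' : ψ h.2 = 1 := hφh
          have hφk' : ψ k.2 = 1 := hφk
          refine hg (h0 * h) (mul_mem hh0 hh) (k * k0) (mul_mem hk hk0) ?_ ?_
          · have he' : h.1 * k.1 = h0.1⁻¹ * g.1 * k0.1⁻¹ := he
            calc (h0 * h).1 * (k * k0).1 = h0.1 * (h.1 * k.1) * k0.1 := by
                  simp [mul_assoc]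
              _ = g.1 := by rw [he']; group
          · simp [hφh', hφk', he0])
      obtain ⟨N, hN, hfi, hx⟩ := sep
      refine ⟨N, hN, hfi, fun x hxN h hh k hk he hhr hc => ?_⟩
      have hψk : ψ k.2 = ψ k0.2 := by
        rw [← he0, hhr, hr0] at hc
        exact mul_left_cancel hc
      refine hx (k0.1 * x * k0.1⁻¹) (hN.conj_mem x hxN k0.1) ?_
      refine ⟨h0.1⁻¹ * h.1, ⟨h0⁻¹ * h, ⟨H.mul_mem (H.inv_mem hh0) hh, ?_⟩, rfl⟩,
        k.1 * k0.1⁻¹, ⟨k * k0⁻¹, ⟨K.mul_mem hk (K.inv_mem hk0), ?_⟩, rfl⟩, ?_⟩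
      · change ψ (h0⁻¹ * h).2 = 1
        simp [hhr, hr0]
      · change ψ (k * k0⁻¹).2 = 1
        simp [hψk]
      · calc h0.1⁻¹ * h.1 * (k.1 * k0.1⁻¹) = h0.1⁻¹ * (h.1 * k.1) * k0.1⁻¹ := by
              simp [mul_assoc]
          _ = _ := by rw [he]; group
    · refine ⟨⊤, inferInstance, inferInstance, fun x _ h hh k hk _ hhr hc => ?_⟩
      exact hr ⟨h, hh, k, hk, hhr, hc⟩
  choose N hN hfi hx using key
  have := hfi
  have : (⨅ r, N r).FiniteIndex := Subgroup.finiteIndex_iInf hfi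
  have : (⨅ r, N r).Normal := Subgroup.normal_iInf_normal hN
  have : ((⨅ r, N r).comap (MonoidHom.fst Q (Multiplicative ℤ))).FiniteIndex := by
    constructor
    rw [Subgroup.index_comap_of_surjective _ Prod.fst_surjective]
    exact Subgroup.FiniteIndex.index_ne_zero
  have : φ.ker.FiniteIndex := inferInstance
  refine ⟨(⨅ r, N r).comap (MonoidHom.fst Q (Multiplicative ℤ)) ⊓ φ.ker, inferInstance,
    inferInstance, ?_⟩
  rintro x ⟨hx1, hx2⟩ ⟨h, hh, k, hk, he⟩
  have hx2' : ψ x.2 = 1 := hx2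
  have hx1' : x.1 ∈ ⨅ r, N r := hx1
  have he' : h * k = g * x := he
  refine hx (ψ h.2) x.1 (Subgroup.mem_iInf.1 hx1' _) h hh k hk (congrArg Prod.fst he') rfl ?_
  have := congrArg (fun z => ψ z.2) he'
  simpa [hx2'] using this

theorem double_coset_separable_prod_int
    (Q : Type*) [Group Q] (hQ : DoubleCosetSeparable Q) :
    DoubleCosetSeparable (Q × Multiplicative ℤ) := by
  intro H K hH hK g hg
  suffices hm : ∃ m : ℕ, m ≠ 0 ∧ ∀ h ∈ H, ∀ k ∈ K, h.1 * k.1 = g.1 →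
      ¬ (m : ℤ) ∣ h.2.toAdd + k.2.toAdd - g.2.toAdd by
    obtain ⟨m, hm0, hm⟩ := hm
    have : NeZero m := ⟨hm0⟩
    refine sep_mod_aux hQ (A := Multiplicative (ZMod m))
      (AddMonoidHom.toMultiplicative (Int.castAddHom (ZMod m))) H K hH hK g ?_
    intro h hh k hk he hc
    apply hm h hh k hk he
    rw [← ZMod.intCast_zmod_eq_zero_iff_dvd]
    have hc' : ((h.2.toAdd : ℤ) : ZMod m) + ((k.2.toAdd : ℤ) : ZMod m)
      = ((g.2.toAdd : ℤ) : ZMod m) := hc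
    push_cast
    rw [hc', sub_self]
  by_cases hq : ∃ h ∈ H, ∃ k ∈ K, h.1 * k.1 = g.1
  swap
  · exact ⟨1, one_ne_zero, fun h hh k hk he => (hq ⟨h, hh, k, hk, he⟩).elim⟩
  obtain ⟨h0, hh0, k0, hk0, he0⟩ := hq
  let D : AddSubgroup ℤ :=
    { carrier := {d | ∃ h ∈ H, ∃ k ∈ K, h.1 = k.1 ∧ d = h.2.toAdd - k.2.toAdd}
      zero_mem' := ⟨1, one_mem _, 1, one_mem _, rfl, by simp⟩
      add_mem' := by
        rintro _ _ ⟨h, hh, k, hk, he, rfl⟩ ⟨h', hh', k', hk', he', rfl⟩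
        exact ⟨h * h', mul_mem hh hh', k * k', mul_mem hk hk', by simp [he, he'],
          by simp; ring⟩
      neg_mem' := by
        rintro _ ⟨h, hh, k, hk, he, rfl⟩
        exact ⟨h⁻¹, inv_mem hh, k⁻¹, inv_mem hk, by simp [he], by simp; ring⟩ }
  set n : ℤ := g.2.toAdd - h0.2.toAdd - k0.2.toAdd with hn
  have hnD : n ∉ D := by
    rintro ⟨h, hh, k, hk, he, hd⟩
    apply hg
    refine ⟨h0 * h, mul_mem hh0 hh, k⁻¹ * k0, mul_mem (inv_mem hk) hk0, ?_⟩
    apply Prod.ext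
    · change h0.1 * h.1 * (k.1⁻¹ * k0.1) = g.1
      rw [he, ← he0]; group
    · apply Multiplicative.toAdd.injective
      change h0.2.toAdd + h.2.toAdd + (-k.2.toAdd + k0.2.toAdd) = g.2.toAdd
      linarith
  have hex : ∃ m : ℕ, m ≠ 0 ∧ (∀ d ∈ D, (m : ℤ) ∣ d) ∧ ¬ (m : ℤ) ∣ n := by
    obtain ⟨d, hd⟩ := Int.subgroup_cyclic D
    have hdm : ∀ x, x ∈ D ↔ d ∣ x := by
      intro x
      rw [hd, ← AddSubgroup.zmultiples_eq_closure, Int.mem_zmultiples_iff]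
    by_cases h0 : d = 0
    · refine ⟨n.natAbs + 1, by omega, fun x hx => ?_, fun hc => ?_⟩
      · have := (hdm x).1 hx
        rw [h0, zero_dvd_iff] at this
        simp [this]
      · have := Int.eq_zero_of_abs_lt_dvd hc (by push_cast; simp)
        exact hnD (this ▸ D.zero_mem)
    · refine ⟨d.natAbs, by simpa using h0, fun x hx => ?_, fun hc => ?_⟩
      · exact Int.natAbs_dvd.2 ((hdm x).1 hx)
      · exact hnD ((hdm n).2 (Int.natAbs_dvd.1 hc))
  obtain ⟨m, hm0, hmD, hmn⟩ := hex
  refine ⟨m, hm0, fun h hh k hk he hc => hmn ?_⟩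
  have h1 := hmD ((h.2.toAdd - h0.2.toAdd) - (k0.2.toAdd - k.2.toAdd))
    ⟨h0⁻¹ * h, mul_mem (inv_mem hh0) hh, k0 * k⁻¹, mul_mem hk0 (inv_mem hk), ?_, by simp; ring⟩
  · have := dvd_sub h1 hc
    have e : n = h.2.toAdd - h0.2.toAdd - (k0.2.toAdd - k.2.toAdd)
        - (h.2.toAdd + k.2.toAdd - g.2.toAdd) := by
      rw [hn]; ring
    rw [e]; exact this
  · change h0.1⁻¹ * h.1 = k0.1 * k.1⁻¹
    rw [inv_mul_eq_iff_eq_mul, ← mul_assoc, he0, ← he]; group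
end

section
/- Let G be a group containing elements a and b that commute and generate a free abelian subgroup of rank 2 (that is, aᵐbⁿ = 1 implies m = n = 0 for integers m, n). Set H = ⟨a⟩ and K = ⟨b⟩. Then for each n ≥ 1 the tuple (aⁿ, bⁿ, a⁻ⁿ, b⁻ⁿ) is a product representative of the identity element with respect to the subgroups (H, K, H, K), these product representatives are pairwise inequivalent, and consequently G does not have bottlenecked product representatives over the class of cyclic subgroups. -/
open scoped Pointwise

lemma nb_inter {G : Type*} [Group G] {a b : G}
    (hfree : ∀ m n : ℤ, a ^ m * b ^ n = 1 → m = 0 ∧ n = 0) {x : G}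
    (ha : x ∈ Subgroup.zpowers a) (hb : x ∈ Subgroup.zpowers b) : x = 1 := by
  obtain ⟨m, rfl⟩ := Subgroup.mem_zpowers_iff.mp ha
  obtain ⟨n, hn⟩ := Subgroup.mem_zpowers_iff.mp hb
  have := hfree m (-n) (by rw [zpow_neg, hn, mul_inv_cancel])
  rw [this.1, zpow_zero]

lemma nb_eq {G : Type*} [Group G] {a b : G}
    (hfree : ∀ m n : ℤ, a ^ m * b ^ n = 1 → m = 0 ∧ n = 0) {h k : Fin 4 → G}
    (H : RepEquiv
      ![Subgroup.zpowers a, Subgroup.zpowers b, Subgroup.zpowers a, Subgroup.zpowers b] h k) :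
    h = k := by
  obtain ⟨s, h0, h4, hs, he⟩ := H
  have h1 : s 1 = 1 := by
    have := hs 0 (by decide)
    exact nb_inter hfree this.1 this.2
  have h2 : s 2 = 1 := by
    have := hs 1 (by decide)
    exact nb_inter hfree this.2 this.1
  have h3 : s 3 = 1 := by
    have := hs 2 (by decide)
    exact nb_inter hfree this.1 this.2
  have e : ∀ j, s j = 1 := by
    intro j
    fin_cases j
    exacts [h0, h1, h2, h3, h4]
  funext i
  have := he i
  rw [e, e, one_mul, mul_one] at this
  exact this.symm

lemma nb_inj {G : Type*} [Group G] {a b : G}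
    (hfree : ∀ m n : ℤ, a ^ m * b ^ n = 1 → m = 0 ∧ n = 0) :
    (∀ m n : ℕ, a ^ m = a ^ n → m = n) ∧ (∀ m n : ℕ, b ^ m = b ^ n → m = n) := by
  constructor
  · intro m n h
    have := (hfree (m - n) 0 (by simp [zpow_sub, h])).1
    omega
  · intro m n h
    have := (hfree 0 (m - n) (by simp [zpow_sub, h])).2
    omega

lemma nb_rep {G : Type*} [Group G] {a b : G} (hcomm : a * b = b * a) (n : ℕ) :
    IsProductRep
      ![Subgroup.zpowers a, Subgroup.zpowers b, Subgroup.zpowers a, Subgroup.zpowers b]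
      (1 : G) ![a ^ n, b ^ n, (a ^ n)⁻¹, (b ^ n)⁻¹] := by
  constructor
  · have ha : a ^ n ∈ Subgroup.zpowers a := Subgroup.npow_mem_zpowers a n
    have hb : b ^ n ∈ Subgroup.zpowers b := Subgroup.npow_mem_zpowers b n
    intro i
    fin_cases i
    exacts [ha, hb, inv_mem ha, inv_mem hb]
  · have hc : a ^ n * b ^ n = b ^ n * a ^ n := (Commute.pow_pow (show Commute a b from hcomm) n n)
    simp [List.ofFn_succ]
    rw [← mul_assoc, hc]
    group

/-- in a group containing a free abelian subgroup of rank two generated by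
`a` and `b`, the tuples `(aⁿ, bⁿ, a⁻ⁿ, b⁻ⁿ)` are pairwise inequivalent product
representatives of the identity over `(⟨a⟩, ⟨b⟩, ⟨a⟩, ⟨b⟩)`, and the group fails to have
bottlenecked product representatives over cyclic subgroups. -/
theorem no_bottlenecked_reps_of_free_abelian
    (G : Type*) [Group G] (a b : G) (hcomm : a * b = b * a)
    (hfree : ∀ m n : ℤ, a ^ m * b ^ n = 1 → m = 0 ∧ n = 0) :
    (∀ n : ℕ, 1 ≤ n →
      IsProductRep
        ![Subgroup.zpowers a, Subgroup.zpowers b, Subgroup.zpowers a, Subgroup.zpowers b]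
        (1 : G) ![a ^ n, b ^ n, (a ^ n)⁻¹, (b ^ n)⁻¹]) ∧
    (∀ m n : ℕ, 1 ≤ m → 1 ≤ n → m ≠ n →
      ¬ RepEquiv
        ![Subgroup.zpowers a, Subgroup.zpowers b, Subgroup.zpowers a, Subgroup.zpowers b]
        ![a ^ m, b ^ m, (a ^ m)⁻¹, (b ^ m)⁻¹] ![a ^ n, b ^ n, (a ^ n)⁻¹, (b ^ n)⁻¹]) ∧
    ¬ HasBottleneckedProductReps G (fun W => ∃ g : G, W = Subgroup.zpowers g) := by
  have hinj := nb_inj hfree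
  refine ⟨fun n _ => nb_rep hcomm n, ?_, ?_⟩
  · intro m n _ _ hmn h
    exact hmn (hinj.1 m n (congrFun (nb_eq hfree h) 0))
  · intro hB
    obtain ⟨R, -, ⟨i, hfin⟩, hR⟩ := hB 4 (by norm_num)
      ![Subgroup.zpowers a, Subgroup.zpowers b, Subgroup.zpowers a, Subgroup.zpowers b]
      (by
        intro i
        fin_cases i
        exacts [⟨a, rfl⟩, ⟨b, rfl⟩, ⟨a, rfl⟩, ⟨b, rfl⟩]) 1
      (by
        simp only [List.ofFn_succ, List.ofFn_zero, List.prod_cons, List.prod_nil]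
        refine Set.mem_mul.mpr ⟨1, one_mem _, _, Set.mem_mul.mpr ⟨1, one_mem _, _,
          Set.mem_mul.mpr ⟨1, one_mem _, _, Set.mem_mul.mpr ⟨1, one_mem _, 1, Set.mem_one.mpr rfl, rfl⟩,
            rfl⟩, rfl⟩, by simp⟩)
    have hmem : ∀ n : ℕ, (![a ^ n, b ^ n, (a ^ n)⁻¹, (b ^ n)⁻¹] : Fin 4 → G) ∈ R := by
      intro n
      obtain ⟨k, hk, he⟩ := hR _ (nb_rep hcomm n)
      rw [nb_eq hfree he]
      exact hk
    refine Set.infinite_of_injective_forall_mem (f := fun n : ℕ =>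
      (![a ^ n, b ^ n, (a ^ n)⁻¹, (b ^ n)⁻¹] : Fin 4 → G) i) ?_
      (fun n => Set.mem_image_of_mem (fun h : Fin 4 → G => h i) (hmem n)) hfin
    intro m n h
    fin_cases i
    · exact hinj.1 m n h
    · exact hinj.2 m n h
    · exact hinj.1 m n (inv_injective h)
    · exact hinj.2 m n (inv_injective h)
end
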